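/- Let X be a Banach space and Γ : [0,1] → cwk(X) a scalarly Henstock–Kurzweil integrable multifunction. The following are equivalent: (i) Γ is ℋ-integrable; (ii) Γ has at least one ℋ-integrable selection and for every ℋ-integrable selection f of Γ the multifunction t ↦ Γ(t) − f(t) is Birkhoff integrable; (iii) there exists an ℋ-integrable selection f of Γ such that t ↦ Γ(t) − f(t) is Birkhoff integrable. -/

import Mathlib

open Set Metric MeasureTheory Pointwise
open scoped ENNReal NNReal

namespace GaugePaper

variable (X : Type*) [NormedAddCommGroup X] [NormedSpace ℝ X]

/-- `A ∈ cwk(X)`: `A` is a nonempty, convex and weakly compact subset of `X`. -/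
def IsCWK (A : Set X) : Prop :=
  A.Nonempty ∧ Convex ℝ A ∧ IsCompact (toWeakSpace ℝ X '' A)

variable {X}

/-- The support function `σ(x*, A)`. -/
noncomputable def suppFn (x' : X →L[ℝ] ℝ) (A : Set X) : ℝ := sSup (x' '' A)

/-- `‖A‖ = sup {‖x‖ : x ∈ A}`. -/
noncomputable def setNorm (A : Set X) : ℝ := sSup ((fun x => ‖x‖) '' A)

/-- A gauge on `[0,1]`: a positive function. -/
def IsGauge (δ : ℝ → ℝ) : Prop := ∀ t ∈ Icc (0:ℝ) 1, 0 < δ t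

/-- A tagged partition of `[0,1]` into `n` (possibly degenerate) nonoverlapping closed
subintervals `[pt i, pt (i+1)]`, with tags `tag i ∈ [0,1]`. -/
structure TP (n : ℕ) where
  pt : Fin (n + 1) → ℝ
  tag : Fin n → ℝ
  mono : Monotone pt
  first : pt 0 = 0
  last : pt (Fin.last n) = 1
  tagMem : ∀ i, tag i ∈ Icc (0:ℝ) 1

namespace TP

variable {n : ℕ} (P : TP n)

/-- The `i`-th subinterval of the partition. -/
def ivl (i : Fin n) : Set ℝ := Icc (P.pt i.castSucc) (P.pt i.succ)

/-- The length `|I_i|` of the `i`-th subinterval. -/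
def len (i : Fin n) : ℝ := P.pt i.succ - P.pt i.castSucc

/-- A Perron (Henstock) partition: each tag belongs to its interval. -/
def IsPerron : Prop := ∀ i, P.tag i ∈ P.ivl i

/-- `δ`-fineness: `I_i ⊆ (t_i - δ(t_i), t_i + δ(t_i))`. -/
def IsFine (δ : ℝ → ℝ) : Prop :=
  ∀ i, P.ivl i ⊆ Ioo (P.tag i - δ (P.tag i)) (P.tag i + δ (P.tag i))

/-- An interior Henstock partition: each tag is in the interior of its interval, except
possibly for intervals containing `0` or `1`, where the tag may also be `0` or `1`. -/
def IsInterior : Prop :=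
  ∀ i, P.tag i ∈ Ioo (P.pt i.castSucc) (P.pt i.succ) ∨
    (((0:ℝ) ∈ P.ivl i ∨ (1:ℝ) ∈ P.ivl i) ∧ P.tag i ∈ P.ivl i ∩ ({0, 1} : Set ℝ))

end TP

/-- Riemann sum of a multifunction: `∑ i |I_i| • Γ(t_i)` (Minkowski sums). -/
def mSum {n : ℕ} (P : TP n) (Γ : ℝ → Set X) : Set X :=
  ∑ i : Fin n, P.len i • Γ (P.tag i)

/-- Riemann sum of a function: `∑ i |I_i| • f(t_i)`. -/
def fSum {n : ℕ} (P : TP n) (f : ℝ → X) : X :=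
  ∑ i : Fin n, P.len i • f (P.tag i)

/-! ### Gauge integrals of multifunctions -/

/-- Henstock integrability of a multifunction `Γ : [0,1] → cwk(X)`. -/
def HenstockIntegrable (Γ : ℝ → Set X) : Prop :=
  ∃ I : Set X, IsCWK X I ∧ ∀ ε > 0, ∃ δ : ℝ → ℝ, IsGauge δ ∧
    ∀ (n : ℕ) (P : TP n), P.IsPerron → P.IsFine δ → hausdorffDist I (mSum P Γ) < ε

/-- McShane integrability of a multifunction (free tags). -/
def McShaneIntegrable (Γ : ℝ → Set X) : Prop :=
  ∃ I : Set X, IsCWK X I ∧ ∀ ε > 0, ∃ δ : ℝ → ℝ, IsGauge δ ∧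
    ∀ (n : ℕ) (P : TP n), P.IsFine δ → hausdorffDist I (mSum P Γ) < ε

/-- `ℋ`-integrability: Henstock integrability with Lebesgue measurable gauges. -/
def HMeasIntegrable (Γ : ℝ → Set X) : Prop :=
  ∃ I : Set X, IsCWK X I ∧ ∀ ε > 0, ∃ δ : ℝ → ℝ, IsGauge δ ∧ AEMeasurable δ volume ∧
    ∀ (n : ℕ) (P : TP n), P.IsPerron → P.IsFine δ → hausdorffDist I (mSum P Γ) < ε

/-- Birkhoff (`ℳ`-) integrability: McShane integrability with Lebesgue measurable gauges. -/
def BirkhoffIntegrable (Γ : ℝ → Set X) : Prop :=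
  ∃ I : Set X, IsCWK X I ∧ ∀ ε > 0, ∃ δ : ℝ → ℝ, IsGauge δ ∧ AEMeasurable δ volume ∧
    ∀ (n : ℕ) (P : TP n), P.IsFine δ → hausdorffDist I (mSum P Γ) < ε

/-! ### Gauge integrals of (single-valued) functions -/

/-- Henstock integrability of a function `f : [0,1] → X`. -/
def FHenstockIntegrable (f : ℝ → X) : Prop :=
  ∃ w : X, ∀ ε > 0, ∃ δ : ℝ → ℝ, IsGauge δ ∧
    ∀ (n : ℕ) (P : TP n), P.IsPerron → P.IsFine δ → ‖w - fSum P f‖ < ε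

/-- McShane integrability of a function. -/
def FMcShaneIntegrable (f : ℝ → X) : Prop :=
  ∃ w : X, ∀ ε > 0, ∃ δ : ℝ → ℝ, IsGauge δ ∧
    ∀ (n : ℕ) (P : TP n), P.IsFine δ → ‖w - fSum P f‖ < ε

/-- `ℋ`-integrability of a function: measurable gauges. -/
def FHMeasIntegrable (f : ℝ → X) : Prop :=
  ∃ w : X, ∀ ε > 0, ∃ δ : ℝ → ℝ, IsGauge δ ∧ AEMeasurable δ volume ∧
    ∀ (n : ℕ) (P : TP n), P.IsPerron → P.IsFine δ → ‖w - fSum P f‖ < ε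

/-- Birkhoff (`ℳ`-) integrability of a function: McShane with measurable gauges. -/
def FBirkhoffIntegrable (f : ℝ → X) : Prop :=
  ∃ w : X, ∀ ε > 0, ∃ δ : ℝ → ℝ, IsGauge δ ∧ AEMeasurable δ volume ∧
    ∀ (n : ℕ) (P : TP n), P.IsFine δ → ‖w - fSum P f‖ < ε

/-- Henstock–Kurzweil integrability of a real-valued function on `[0,1]`. -/
def HKIntegrable (g : ℝ → ℝ) : Prop :=
  ∃ A : ℝ, ∀ ε > 0, ∃ δ : ℝ → ℝ, IsGauge δ ∧
    ∀ (n : ℕ) (P : TP n), P.IsPerron → P.IsFine δ → |fSum P g - A| < ε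

/-! ### Pettis integrals -/

/-- Pettis integrability of a function `f : [0,1] → X`. -/
def FPettisIntegrable (f : ℝ → X) : Prop :=
  (∀ x' : X →L[ℝ] ℝ, IntegrableOn (fun t => x' (f t)) (Icc (0:ℝ) 1) volume) ∧
  ∀ E ⊆ Icc (0:ℝ) 1, NullMeasurableSet E volume →
    ∃ ν : X, ∀ x' : X →L[ℝ] ℝ, x' ν = ∫ t in E, x' (f t)

/-- Pettis integrability of a multifunction `Γ : [0,1] → cwk(X)`. -/
def PettisIntegrable (Γ : ℝ → Set X) : Prop :=
  (∀ x' : X →L[ℝ] ℝ, IntegrableOn (fun t => suppFn x' (Γ t)) (Icc (0:ℝ) 1) volume) ∧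
  ∀ E ⊆ Icc (0:ℝ) 1, NullMeasurableSet E volume →
    ∃ W : Set X, IsCWK X W ∧ ∀ x' : X →L[ℝ] ℝ, suppFn x' W = ∫ t in E, suppFn x' (Γ t)

/-- `f` is a selection of `Γ`. -/
def Selection (Γ : ℝ → Set X) (f : ℝ → X) : Prop := ∀ t ∈ Icc (0:ℝ) 1, f t ∈ Γ t

/-! ### Variational integrals -/

/-- Finite additivity of an interval multifunction on subintervals of `[0,1]`
(an interval `[a,b] ⊆ [0,1]` is encoded by its endpoints). -/
def AdditiveIntervalMF (Φ : ℝ → ℝ → Set X) : Prop :=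
  ∀ a b c : ℝ, 0 ≤ a → a ≤ b → b ≤ c → c ≤ 1 → Φ a c = Φ a b + Φ b c

/-- Finite additivity of a vector-valued interval function on subintervals of `[0,1]`. -/
def AdditiveIntervalF (Φ : ℝ → ℝ → X) : Prop :=
  ∀ a b c : ℝ, 0 ≤ a → a ≤ b → b ≤ c → c ≤ 1 → Φ a c = Φ a b + Φ b c

/-- `Φ` is a variational Henstock primitive of the multifunction `Γ`. -/
def vHPrimitive (Γ : ℝ → Set X) (Φ : ℝ → ℝ → Set X) : Prop :=
  (∀ a b : ℝ, 0 ≤ a → a ≤ b → b ≤ 1 → IsCWK X (Φ a b)) ∧ AdditiveIntervalMF Φ ∧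
  ∀ ε > 0, ∃ δ : ℝ → ℝ, IsGauge δ ∧ ∀ (n : ℕ) (P : TP n), P.IsPerron → P.IsFine δ →
    ∑ i : Fin n, hausdorffDist (Φ (P.pt i.castSucc) (P.pt i.succ)) (P.len i • Γ (P.tag i)) < ε

/-- Variational Henstock integrability of a multifunction. -/
def vHIntegrable (Γ : ℝ → Set X) : Prop := ∃ Φ : ℝ → ℝ → Set X, vHPrimitive Γ Φ

/-- Variational McShane integrability of a multifunction (free tags). -/
def vMSIntegrable (Γ : ℝ → Set X) : Prop :=
  ∃ Φ : ℝ → ℝ → Set X,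
    (∀ a b : ℝ, 0 ≤ a → a ≤ b → b ≤ 1 → IsCWK X (Φ a b)) ∧ AdditiveIntervalMF Φ ∧
    ∀ ε > 0, ∃ δ : ℝ → ℝ, IsGauge δ ∧ ∀ (n : ℕ) (P : TP n), P.IsFine δ →
      ∑ i : Fin n, hausdorffDist (Φ (P.pt i.castSucc) (P.pt i.succ)) (P.len i • Γ (P.tag i)) < ε

/-- Variational `ℋ`-integrability of a multifunction: measurable gauges. -/
def vHMeasIntegrable (Γ : ℝ → Set X) : Prop :=
  ∃ Φ : ℝ → ℝ → Set X,
    (∀ a b : ℝ, 0 ≤ a → a ≤ b → b ≤ 1 → IsCWK X (Φ a b)) ∧ AdditiveIntervalMF Φ ∧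
    ∀ ε > 0, ∃ δ : ℝ → ℝ, IsGauge δ ∧ AEMeasurable δ volume ∧
      ∀ (n : ℕ) (P : TP n), P.IsPerron → P.IsFine δ →
        ∑ i : Fin n, hausdorffDist (Φ (P.pt i.castSucc) (P.pt i.succ)) (P.len i • Γ (P.tag i)) < ε

/-- `Φ` is a variational Henstock primitive of the function `f`. -/
def FvHPrimitive (f : ℝ → X) (Φ : ℝ → ℝ → X) : Prop :=
  AdditiveIntervalF Φ ∧
  ∀ ε > 0, ∃ δ : ℝ → ℝ, IsGauge δ ∧ ∀ (n : ℕ) (P : TP n), P.IsPerron → P.IsFine δ →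
    ∑ i : Fin n, ‖Φ (P.pt i.castSucc) (P.pt i.succ) - P.len i • f (P.tag i)‖ < ε

/-- Variational Henstock integrability of a function. -/
def FvHIntegrable (f : ℝ → X) : Prop := ∃ Φ : ℝ → ℝ → X, FvHPrimitive f Φ

/-- Variational McShane integrability of a function (free tags). -/
def FvMSIntegrable (f : ℝ → X) : Prop :=
  ∃ Φ : ℝ → ℝ → X, AdditiveIntervalF Φ ∧
    ∀ ε > 0, ∃ δ : ℝ → ℝ, IsGauge δ ∧ ∀ (n : ℕ) (P : TP n), P.IsFine δ →
      ∑ i : Fin n, ‖Φ (P.pt i.castSucc) (P.pt i.succ) - P.len i • f (P.tag i)‖ < ε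

/-- Variational `ℋ`-integrability of a function: measurable gauges. -/
def FvHMeasIntegrable (f : ℝ → X) : Prop :=
  ∃ Φ : ℝ → ℝ → X, AdditiveIntervalF Φ ∧
    ∀ ε > 0, ∃ δ : ℝ → ℝ, IsGauge δ ∧ AEMeasurable δ volume ∧
      ∀ (n : ℕ) (P : TP n), P.IsPerron → P.IsFine δ →
        ∑ i : Fin n, ‖Φ (P.pt i.castSucc) (P.pt i.succ) - P.len i • f (P.tag i)‖ < ε

/-! ### Partial Perron partitions and variational measures -/

/-- A finite tagged Perron family of `n` nonoverlapping closed subintervals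
`[a i, b i]` of `[0,1]` (a "partition in `[0,1]`", not necessarily covering it). -/
structure PTP (n : ℕ) where
  a : Fin n → ℝ
  b : Fin n → ℝ
  tag : Fin n → ℝ
  le : ∀ i, a i ≤ b i
  sub : ∀ i, Icc (a i) (b i) ⊆ Icc (0:ℝ) 1
  nonoverlap : ∀ i j, i ≠ j → (Icc (a i) (b i) ∩ Icc (a j) (b j)).Subsingleton
  perron : ∀ i, tag i ∈ Icc (a i) (b i)

/-- `δ`-fineness of a partial Perron family. -/
def PTP.IsFine {n : ℕ} (P : PTP n) (δ : ℝ → ℝ) : Prop :=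
  ∀ i, Icc (P.a i) (P.b i) ⊆ Ioo (P.tag i - δ (P.tag i)) (P.tag i + δ (P.tag i))

/-- `Var(Ψ, δ, E)` for a scalar interval function `Ψ`. -/
noncomputable def scVar (Ψ : ℝ → ℝ → ℝ) (δ : ℝ → ℝ) (E : Set ℝ) : ℝ≥0∞ :=
  ⨆ (n : ℕ) (P : PTP n) (_ : P.IsFine δ ∧ ∀ i, P.tag i ∈ E),
    ∑ i : Fin n, ENNReal.ofReal |Ψ (P.a i) (P.b i)|

/-- The variational measure `V_Ψ(E)` generated by a scalar interval function `Ψ`. -/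
noncomputable def scVarMeasure (Ψ : ℝ → ℝ → ℝ) (E : Set ℝ) : ℝ≥0∞ :=
  ⨅ (δ : ℝ → ℝ) (_ : IsGauge δ), scVar Ψ δ E


section Decomposition

/-- `PerronSum δ b a S` says that `S g` is, simultaneously for all `g`, the Riemann sum of `g`
over one `δ`-fine Perron partition of `[a, b]`. -/
inductive PerronSum (δ : ℝ → ℝ) (b : ℝ) : ℝ → ((ℝ → ℝ) → ℝ) → Prop
  | nil : PerronSum δ b b fun _ => 0
  | cons {a x t : ℝ} {S : (ℝ → ℝ) → ℝ} (hat : a ≤ t) (htx : t ≤ x)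
      (hfine : Icc a x ⊆ Ioo (t - δ t) (t + δ t)) (hS : PerronSum δ b x S) :
      PerronSum δ b a fun g => (x - a) * g t + S g

namespace PerronSum

variable {δ : ℝ → ℝ} {a b c : ℝ} {S T : (ℝ → ℝ) → ℝ}

theorem append (hS : PerronSum δ b a S) (hT : PerronSum δ c b T) :
    PerronSum δ c a fun g => S g + T g := by
  induction hS with
  | nil => simpa using hT
  | cons hat htx hfine _ ih => simpa only [add_assoc] using cons hat htx hfine ih

theorem single {t : ℝ} (hat : a ≤ t) (htb : t ≤ b)
    (hfine : Icc a b ⊆ Ioo (t - δ t) (t + δ t)) :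
    PerronSum δ b a fun g => (b - a) * g t := by
  simpa using cons hat htb hfine nil

/-- Cousin's lemma. -/
theorem exists_of_pos (hab : a ≤ b) (hδ : ∀ t ∈ Icc a b, 0 < δ t) :
    ∃ S, PerronSum δ b a S := by
  set s : Set ℝ := {x | x ∈ Icc a b ∧ ∃ S, PerronSum δ x a S} with hs
  have has : a ∈ s := ⟨⟨le_rfl, hab⟩, _, nil⟩
  have hbdd : BddAbove s := ⟨b, fun x hx => hx.1.2⟩
  have hc : sSup s ∈ Icc a b := ⟨le_csSup hbdd has, csSup_le ⟨a, has⟩ fun x hx => hx.1.2⟩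
  have hpos := hδ _ hc
  obtain ⟨x, hx, hxc⟩ := exists_lt_of_lt_csSup ⟨a, has⟩ (sub_lt_self (sSup s) hpos)
  have hxle : x ≤ sSup s := le_csSup hbdd hx
  set y := min b (sSup s + δ (sSup s) / 2) with hy
  have hcy : sSup s ≤ y := le_min hc.2 (by linarith)
  have hy' : y ≤ sSup s + δ (sSup s) / 2 := min_le_right _ _
  obtain ⟨S, hS⟩ := hx.2
  have hys : PerronSum δ y a _ := hS.append (single hxle hcy fun z hz =>
    ⟨by linarith [hz.1], by linarith [hz.2]⟩)
  have : y ≤ sSup s := le_csSup hbdd ⟨⟨hc.1.trans hcy, min_le_left _ _⟩, _, hys⟩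
  rcases min_choice b (sSup s + δ (sSup s) / 2) with h | h
  · rw [← h]
    exact ⟨_, hys⟩
  · rw [← hy] at h
    linarith

theorem exists_points (hS : PerronSum δ b a S) :
    ∃ (n : ℕ) (pt : Fin (n + 1) → ℝ) (tag : Fin n → ℝ), Monotone pt ∧ pt 0 = a ∧
      pt (Fin.last n) = b ∧ (∀ i, tag i ∈ Icc (pt i.castSucc) (pt i.succ)) ∧
      (∀ i, Icc (pt i.castSucc) (pt i.succ) ⊆ Ioo (tag i - δ (tag i)) (tag i + δ (tag i))) ∧
      ∀ g : ℝ → ℝ, ∑ i, (pt i.succ - pt i.castSucc) * g (tag i) = S g := by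
  induction hS with
  | nil =>
    exact ⟨0, fun _ => b, Fin.elim0, monotone_const, rfl, rfl, fun i => i.elim0,
      fun i => i.elim0, fun g => by simp⟩
  | @cons a x t S hat htx hfine _ ih =>
    obtain ⟨n, pt, tag, hmono, hfirst, hlast, htag, hf, hsum⟩ := ih
    refine ⟨n + 1, Fin.cons a pt, Fin.cons t tag, ?_, by simp, ?_, ?_, ?_, ?_⟩
    · rw [Fin.monotone_iff_le_succ]
      intro i
      refine Fin.cases ?_ (fun i => ?_) i
      · simpa [hfirst] using hat.trans htx
      · simpa [← Fin.succ_castSucc] using hmono (Fin.castSucc_le_succ i)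
    · rw [← Fin.succ_last, Fin.cons_succ, hlast]
    · intro i
      refine Fin.cases ?_ (fun i => ?_) i
      · simpa [hfirst] using ⟨hat, htx⟩
      · simpa [← Fin.succ_castSucc] using htag i
    · intro i
      refine Fin.cases ?_ (fun i => ?_) i
      · simpa [hfirst] using hfine
      · simpa only [← Fin.succ_castSucc, Fin.cons_succ] using hf i
    · intro g
      rw [Fin.sum_univ_succ]
      simp [← hsum g, hfirst]

theorem exists_tp (hS : PerronSum δ 1 0 S) :
    ∃ (n : ℕ) (P : TP n), P.IsPerron ∧ P.IsFine δ ∧ ∀ g : ℝ → ℝ, fSum P g = S g := by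
  obtain ⟨n, pt, tag, hmono, hfirst, hlast, htag, hf, hsum⟩ := hS.exists_points
  exact ⟨n, ⟨pt, tag, hmono, hfirst, hlast, fun i =>
    ⟨hfirst ▸ (hmono (Fin.zero_le _)).trans (htag i).1,
      hlast ▸ (htag i).2.trans (hmono (Fin.le_last _))⟩⟩, htag, hf, hsum⟩

end PerronSum

theorem IsGauge.exists_perron {δ : ℝ → ℝ} (hδ : IsGauge δ) :
    ∃ (n : ℕ) (P : TP n), P.IsPerron ∧ P.IsFine δ := by
  obtain ⟨S, hS⟩ := PerronSum.exists_of_pos zero_le_one hδ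
  obtain ⟨n, P, h1, h2, -⟩ := hS.exists_tp
  exact ⟨n, P, h1, h2⟩

theorem IsGauge.min {δ δ' : ℝ → ℝ} (hδ : IsGauge δ) (hδ' : IsGauge δ') :
    IsGauge fun t => min (δ t) (δ' t) :=
  fun t ht => lt_min (hδ t ht) (hδ' t ht)

namespace TP

variable {n : ℕ} (P : TP n)

theorem IsFine.mono {P : TP n} {δ δ' : ℝ → ℝ} (h : P.IsFine δ) (hle : ∀ t, δ t ≤ δ' t) :
    P.IsFine δ' :=
  fun i => (h i).trans (Ioo_subset_Ioo (by linarith [hle (P.tag i)]) (by linarith [hle (P.tag i)]))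

theorem len_nonneg (i : Fin n) : 0 ≤ P.len i :=
  sub_nonneg.2 (P.mono (Fin.castSucc_le_succ i))

theorem sum_len : ∑ i, P.len i = 1 := by
  have h : ∀ (m : ℕ) (f : Fin (m + 1) → ℝ),
      ∑ i : Fin m, (f i.succ - f i.castSucc) = f (Fin.last m) - f 0 := by
    intro m
    induction m with
    | zero => intro f; simp
    | succ m ih =>
      intro f
      rw [Fin.sum_univ_castSucc]
      have := ih (fun i => f i.castSucc)
      simp only [← Fin.succ_castSucc, Fin.castSucc_zero] at this ⊢
      rw [this, Fin.succ_last]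
      ring
  have := h n P.pt
  rw [P.first, P.last, sub_zero] at this
  exact this

theorem pairwise_disjoint_Ico :
    Pairwise (Function.onFun Disjoint fun i : Fin n => Ico (P.pt i.castSucc) (P.pt i.succ)) := by
  have key : ∀ i j : Fin n, i < j →
      Disjoint (Ico (P.pt i.castSucc) (P.pt i.succ)) (Ico (P.pt j.castSucc) (P.pt j.succ)) := by
    intro i j hij
    rw [Set.disjoint_left]
    intro x hx hx'
    have : P.pt i.succ ≤ P.pt j.castSucc := P.mono (by
      rw [Fin.le_def]; simpa using hij)
    exact absurd (hx.2.trans_le (this.trans hx'.1)) (lt_irrefl _)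
  intro i j hij
  rcases lt_or_gt_of_ne hij with h | h
  · exact key i j h
  · exact (key j i h).symm

theorem sum_len_le_of_subset {s : Finset (Fin n)} {U : Set ℝ} (hU : volume U ≠ ⊤)
    (h : ∀ i ∈ s, P.ivl i ⊆ U) : ∑ i ∈ s, P.len i ≤ volume.real U := by
  have h1 : volume.real (⋃ i ∈ s, Ico (P.pt i.castSucc) (P.pt i.succ)) = ∑ i ∈ s, P.len i := by
    rw [measureReal_biUnion_finset (h := fun i _ => measure_Ico_lt_top.ne)]
    · refine Finset.sum_congr rfl fun i _ => ?_
      rw [Real.volume_real_Ico_of_le (P.mono (Fin.castSucc_le_succ i)), TP.len]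
    · exact fun i _ j _ hij => P.pairwise_disjoint_Ico hij
    · exact fun i _ => measurableSet_Ico
  rw [← h1]
  exact measureReal_mono (iUnion₂_subset fun i hi => Ico_subset_Icc_self.trans (h i hi)) hU

end TP

/-- A measurable gauge for which the intervals of a fine partition whose tags lie in one piece of
a given countable partition have total length at most slightly more than the measure of the
piece. -/
theorem exists_gauge_fiber {ι : Type*} [Countable ι] [DecidableEq ι] (κ : ℝ → ι)
    (hκ : ∀ j, NullMeasurableSet {t | t ∈ Icc (0:ℝ) 1 ∧ κ t = j} volume)
    (η : ι → ℝ) (hη : ∀ j, 0 < η j) :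
    ∃ δ : ℝ → ℝ, IsGauge δ ∧ AEMeasurable δ volume ∧ ∀ (n : ℕ) (P : TP n), P.IsFine δ →
      ∀ j, ∑ i with κ (P.tag i) = j, P.len i
        ≤ volume.real {t | t ∈ Icc (0:ℝ) 1 ∧ κ t = j} + η j := by
  classical
  set A : ι → Set ℝ := fun j => {t | t ∈ Icc (0:ℝ) 1 ∧ κ t = j} with hA
  have hAtop : ∀ j, volume (A j) ≠ ⊤ := fun j =>
    measure_ne_top_of_subset (fun t ht => ht.1) (measure_Icc_lt_top (a := (0:ℝ)) (b := 1)).ne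
  choose V hAV hVo hVm using fun j => (A j).exists_isOpen_le_add volume
    (ENNReal.ofReal_pos.2 (hη j)).ne'
  set U : ι → Set ℝ := fun j => V j ∩ Ioo (-1) 2 with hU
  have hUo : ∀ j, IsOpen (U j) := fun j => (hVo j).inter isOpen_Ioo
  have hAU : ∀ j, A j ⊆ U j := fun j t ht =>
    ⟨hAV j ht, by linarith [ht.1.1], by linarith [ht.1.2]⟩
  have hUne : ∀ j, ((U j)ᶜ).Nonempty := fun j => ⟨2, fun h => lt_irrefl _ h.2.2⟩
  have hUtop : ∀ j, volume (U j) ≠ ⊤ := fun j =>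
    measure_ne_top_of_subset inter_subset_right (by simp)
  have hUm : ∀ j, volume.real (U j) ≤ volume.real (A j) + η j := by
    intro j
    have h1 : volume (U j) ≤ volume (A j) + ENNReal.ofReal (η j) :=
      (measure_mono inter_subset_left).trans (hVm j)
    have h2 := ENNReal.toReal_mono (ENNReal.add_ne_top.2 ⟨hAtop j, ENNReal.ofReal_ne_top⟩) h1
    rwa [ENNReal.toReal_add (hAtop j) ENNReal.ofReal_ne_top,
      ENNReal.toReal_ofReal (hη j).le] at h2
  set δ : ℝ → ℝ := fun t => if t ∈ Icc (0:ℝ) 1 then infDist t (U (κ t))ᶜ else 1 with hδ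
  refine ⟨δ, ?_, ?_, ?_⟩
  · intro t ht
    simp only [hδ, if_pos ht]
    rw [← (hUo _).isClosed_compl.notMem_iff_infDist_pos (hUne _)]
    exact fun h => h (hAU _ ⟨ht, rfl⟩)
  · have h1 : AEMeasurable δ (volume.restrict (Icc (0:ℝ) 1)ᶜ) := by
      refine (aemeasurable_const (b := (1:ℝ))).congr ?_
      filter_upwards [ae_restrict_mem measurableSet_Icc.compl] with t ht
      simp only [hδ, if_neg ht]
    have h2 : AEMeasurable δ (volume.restrict (⋃ j, A j)) := by
      refine aemeasurable_iUnion_iff.2 fun j => ?_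
      refine AEMeasurable.congr (f := fun t => infDist t (U j)ᶜ)
        (continuous_infDist_pt _).measurable.aemeasurable ?_
      filter_upwards [ae_restrict_mem₀ (hκ j)] with t ht
      obtain ⟨ht, rfl⟩ := ht
      simp only [hδ, if_pos ht]
    have h3 : (Icc (0:ℝ) 1)ᶜ ∪ (⋃ j, A j) = univ := by
      refine eq_univ_of_forall fun t => ?_
      by_cases ht : t ∈ Icc (0:ℝ) 1
      · exact Or.inr (mem_iUnion.2 ⟨κ t, ht, rfl⟩)
      · exact Or.inl ht
    rw [← Measure.restrict_univ (μ := (volume : Measure ℝ)), ← h3]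
    exact aemeasurable_union_iff.2 ⟨h1, h2⟩
  · intro n P hP j
    refine (P.sum_len_le_of_subset (hUtop j) fun i hi => ?_).trans (hUm j)
    have hi' : κ (P.tag i) = j := (Finset.mem_filter.1 hi).2
    intro x hx
    have hx' := hP i hx
    have hδi : δ (P.tag i) = infDist (P.tag i) (U j)ᶜ := by
      simp only [hδ, if_pos (P.tagMem i), hi']
    by_contra hxU
    have h1 := infDist_le_dist_of_mem (x := P.tag i) (show x ∈ (U j)ᶜ from hxU)
    rw [hδi] at hx'
    rw [Real.dist_eq] at h1
    have := abs_lt.2 (⟨by linarith [hx'.2], by linarith [hx'.1]⟩ :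
      -infDist (P.tag i) (U j)ᶜ < P.tag i - x ∧ P.tag i - x < infDist (P.tag i) (U j)ᶜ)
    linarith

theorem exists_perronSum_pair {δ : ℝ → ℝ} (hδ : IsGauge δ) {N : ℕ} (hN : 0 < N) {D : ℕ → Set ℝ}
    (hD : ∀ k, D k ⊆ Icc ((k:ℝ) / N) (((k + 1 : ℕ) : ℝ) / N))
    (hr : ∀ k, ∀ t ∈ D k, 1 / (N:ℝ) < δ t) {K : Finset ℕ} {s t : ℕ → ℝ}
    (hs : ∀ k ∈ K, s k ∈ D k) (ht : ∀ k ∈ K, t k ∈ D k) (k : ℕ) (hk : k ≤ N) :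
    ∃ S T, PerronSum δ ((k:ℝ) / N) 0 S ∧ PerronSum δ ((k:ℝ) / N) 0 T ∧
      ∀ g, S g - T g = ∑ i ∈ Finset.range k with i ∈ K, 1 / (N:ℝ) * (g (s i) - g (t i)) := by
  have hN' : (0:ℝ) < N := Nat.cast_pos.2 hN
  induction k with
  | zero =>
    refine ⟨_, _, by simpa using PerronSum.nil, by simpa using PerronSum.nil, fun g => by simp⟩
  | succ k ih =>
    obtain ⟨S, T, hS, hT, hST⟩ := ih (by omega)
    have hlen : ((k + 1 : ℕ) : ℝ) / N - (k:ℝ) / N = 1 / N := by push_cast; ring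
    have hle : (k:ℝ) / N ≤ ((k + 1 : ℕ) : ℝ) / N := by
      have : (0:ℝ) < 1 / N := by positivity
      linarith
    by_cases hkK : k ∈ K
    · have hfine : ∀ x ∈ D k, Icc ((k:ℝ) / N) (((k + 1 : ℕ) : ℝ) / N) ⊆
          Ioo (x - δ x) (x + δ x) := by
        intro x hx y hy
        have h1 := hD k hx
        have h2 := hr k x hx
        exact ⟨by linarith [hy.1, h1.2], by linarith [hy.2, h1.1]⟩
      have h1 := hD k (hs k hkK)
      have h2 := hD k (ht k hkK)
      refine ⟨_, _, hS.append (PerronSum.single h1.1 h1.2 (hfine _ (hs k hkK))),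
        hT.append (PerronSum.single h2.1 h2.2 (hfine _ (ht k hkK))), fun g => ?_⟩
      rw [Finset.range_add_one, Finset.filter_insert, if_pos hkK, Finset.sum_insert (by simp),
        ← hST g, hlen]
      ring
    · obtain ⟨R, hR⟩ := PerronSum.exists_of_pos hle fun x hx => hδ x
        ⟨le_trans (by positivity) hx.1, hx.2.trans (by
          rw [div_le_one hN']; exact_mod_cast hk)⟩
      refine ⟨_, _, hS.append hR, hT.append hR, fun g => ?_⟩
      rw [Finset.range_add_one, Finset.filter_insert, if_neg hkK, ← hST g]
      ring

variable {B : Type*} {h : B → ℝ → ℝ} {c : B → ℝ}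

theorem sum_sub_le_of_perron {δ : ℝ → ℝ} {e : ℝ} (hδ : IsGauge δ)
    (hint : ∀ (n : ℕ) (P : TP n), P.IsPerron → P.IsFine δ → ∀ b, |fSum P (h b) - c b| ≤ e)
    {N : ℕ} (hN : 0 < N) {D : ℕ → Set ℝ}
    (hD : ∀ k, D k ⊆ Icc ((k:ℝ) / N) (((k + 1 : ℕ) : ℝ) / N))
    (hr : ∀ k, ∀ t ∈ D k, 1 / (N:ℝ) < δ t) {K : Finset ℕ} (hK : K ⊆ Finset.range N) {s t : ℕ → ℝ}
    (hs : ∀ k ∈ K, s k ∈ D k) (ht : ∀ k ∈ K, t k ∈ D k) (b : B) :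
    ∑ i ∈ K, 1 / (N:ℝ) * (h b (s i) - h b (t i)) ≤ 2 * e := by
  obtain ⟨S, T, hS, hT, hST⟩ := exists_perronSum_pair hδ hN hD hr hs ht N le_rfl
  rw [div_self (Nat.cast_pos.2 hN).ne'] at hS hT
  obtain ⟨n, P, hP, hPf, hPS⟩ := hS.exists_tp
  obtain ⟨m, Q, hQ, hQf, hQT⟩ := hT.exists_tp
  have h1 := abs_le.1 (hint n P hP hPf b)
  have h2 := abs_le.1 (hint m Q hQ hQf b)
  have h3 := hST (h b)
  rw [Finset.filter_mem_eq_inter, Finset.inter_eq_right.2 hK, ← hPS, ← hQT] at h3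
  linarith [h1.2, h2.1]

/-- The oscillations of a family of functions over the pieces `D k` of a fine grid, when its
Perron sums are uniformly controlled. -/
theorem sum_osc_le_of_perron {δ : ℝ → ℝ} {e : ℝ} (hδ : IsGauge δ)
    (hint : ∀ (n : ℕ) (P : TP n), P.IsPerron → P.IsFine δ → ∀ b, |fSum P (h b) - c b| ≤ e)
    {N : ℕ} (hN : 0 < N) {D : ℕ → Set ℝ}
    (hD : ∀ k, D k ⊆ Icc ((k:ℝ) / N) (((k + 1 : ℕ) : ℝ) / N)) (hDN : ∀ k, (D k).Nonempty → k < N)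
    (hr : ∀ k, ∀ t ∈ D k, 1 / (N:ℝ) < δ t) (b : B) (K : Finset ℕ) :
    ∑ k ∈ K, 1 / (N:ℝ) * (sSup (h b '' D k) - sInf (h b '' D k)) ≤ 2 * e := by
  classical
  have hN' : (0:ℝ) < N := Nat.cast_pos.2 hN
  set K' := K.filter fun k => (D k).Nonempty with hK'
  have hsum : ∑ k ∈ K, 1 / (N:ℝ) * (sSup (h b '' D k) - sInf (h b '' D k)) =
      ∑ k ∈ K', 1 / (N:ℝ) * (sSup (h b '' D k) - sInf (h b '' D k)) := by
    rw [hK', Finset.sum_filter]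
    refine Finset.sum_congr rfl fun k _ => ?_
    split_ifs with hk
    · rfl
    · simp [not_nonempty_iff_eq_empty.1 hk]
  have hK'N : K' ⊆ Finset.range N := fun k hk =>
    Finset.mem_range.2 (hDN k (Finset.mem_filter.1 hk).2)
  rw [hsum]
  refine le_of_forall_pos_le_add fun η hη => ?_
  have hs : ∀ k, ∃ s, k ∈ K' → s ∈ D k ∧ sSup (h b '' D k) - η / 2 < h b s := by
    intro k
    by_cases hk : k ∈ K'
    · obtain ⟨_, ⟨s, hs, rfl⟩, hlt⟩ := exists_lt_of_lt_csSup
        ((Finset.mem_filter.1 hk).2.image (h b)) (sub_lt_self (sSup (h b '' D k)) (half_pos hη))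
      exact ⟨s, fun _ => ⟨hs, hlt⟩⟩
    · exact ⟨0, fun h => absurd h hk⟩
  have ht : ∀ k, ∃ t, k ∈ K' → t ∈ D k ∧ h b t < sInf (h b '' D k) + η / 2 := by
    intro k
    by_cases hk : k ∈ K'
    · obtain ⟨_, ⟨s, hs, rfl⟩, hlt⟩ := exists_lt_of_csInf_lt
        ((Finset.mem_filter.1 hk).2.image (h b)) (lt_add_of_pos_right (sInf (h b '' D k))
          (half_pos hη))
      exact ⟨s, fun _ => ⟨hs, hlt⟩⟩
    · exact ⟨0, fun h => absurd h hk⟩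
  choose s hs using hs
  choose t ht using ht
  have hmain := sum_sub_le_of_perron hδ hint hN hD hr hK'N (fun k hk => (hs k hk).1)
    (fun k hk => (ht k hk).1) b
  calc ∑ k ∈ K', 1 / (N:ℝ) * (sSup (h b '' D k) - sInf (h b '' D k))
      ≤ ∑ k ∈ K', (1 / (N:ℝ) * (h b (s k) - h b (t k)) + 1 / (N:ℝ) * η) := by
        refine Finset.sum_le_sum fun k hk => ?_
        rw [← mul_add]
        refine mul_le_mul_of_nonneg_left ?_ (by positivity)
        linarith [(hs k hk).2, (ht k hk).2]
    _ ≤ 2 * e + η := by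
        rw [Finset.sum_add_distrib, Finset.sum_const, nsmul_eq_mul]
        refine add_le_add hmain ?_
        have : (K'.card : ℝ) ≤ N := by
          exact_mod_cast (Finset.card_le_card hK'N).trans (Finset.card_range N).le
        calc (K'.card : ℝ) * (1 / (N:ℝ) * η) ≤ N * (1 / (N:ℝ) * η) := by gcongr
          _ = η := by field_simp

/-- On a set on which the gauge is bounded below by the mesh of a grid, the family is uniformly
bounded on each cell of the grid. -/
theorem bddAbove_of_perron {δ : ℝ → ℝ} {e : ℝ} (hδ : IsGauge δ)
    (hint : ∀ (n : ℕ) (P : TP n), P.IsPerron → P.IsFine δ → ∀ b, |fSum P (h b) - c b| ≤ e)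
    {N : ℕ} (hN : 0 < N) {D : ℕ → Set ℝ}
    (hD : ∀ k, D k ⊆ Icc ((k:ℝ) / N) (((k + 1 : ℕ) : ℝ) / N)) (hDN : ∀ k, (D k).Nonempty → k < N)
    (hr : ∀ k, ∀ t ∈ D k, 1 / (N:ℝ) < δ t) {C : ℝ → ℝ} (hC : ∀ k, ∀ t ∈ D k, ∀ b, h b t ≤ C t)
    (k : ℕ) : ∃ M, 0 ≤ M ∧ ∀ b, ∀ t ∈ D k, h b t ≤ M := by
  rcases (D k).eq_empty_or_nonempty with hk | ⟨t₀, ht₀⟩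
  · exact ⟨0, le_rfl, fun b t ht => by simp [hk] at ht⟩
  have hN' : (0:ℝ) < N := Nat.cast_pos.2 hN
  refine ⟨max 0 (C t₀ + N * (2 * e)), le_max_left _ _, fun b t ht => le_max_of_le_right ?_⟩
  have := sum_sub_le_of_perron (K := {k}) (s := fun _ => t) (t := fun _ => t₀) hδ hint hN hD hr
    (by simpa using hDN k ⟨t, ht⟩) (by simpa using ht) (by simpa using ht₀) b
  rw [Finset.sum_singleton, one_div, inv_mul_le_iff₀ hN'] at this
  linarith [hC k t₀ ht₀ b]

/-- A gauge with almost everywhere measurable values is bounded below off a set of small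
measure. -/
theorem IsGauge.exists_measure_lt {δ : ℝ → ℝ} (hδ : IsGauge δ) (hm : AEMeasurable δ volume)
    {e : ℝ≥0∞} (he : 0 < e) :
    ∃ N : ℕ, 0 < N ∧ volume {t | t ∈ Icc (0:ℝ) 1 ∧ δ t ≤ 1 / N} < e := by
  set A : ℕ → Set ℝ := fun n => {t | t ∈ Icc (0:ℝ) 1 ∧ δ t ≤ 1 / ((n + 1 : ℕ) : ℝ)} with hA
  have hanti : Antitone A := by
    intro m n hmn t ht
    refine ⟨ht.1, ht.2.trans ?_⟩
    have : ((m + 1 : ℕ) : ℝ) ≤ ((n + 1 : ℕ) : ℝ) := by exact_mod_cast Nat.succ_le_succ hmn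
    exact one_div_le_one_div_of_le (by positivity) this
  have hnull : ∀ n, NullMeasurableSet (A n) volume := fun n =>
    measurableSet_Icc.nullMeasurableSet.inter (nullMeasurableSet_le hm aemeasurable_const)
  have hempty : ⋂ n, A n = ∅ := by
    refine eq_empty_of_forall_notMem fun t ht => ?_
    rw [mem_iInter] at ht
    obtain ⟨n, hn⟩ := exists_nat_one_div_lt (hδ t (ht 0).1)
    have := (ht n).2
    push_cast at this
    linarith
  have hlim := tendsto_measure_iInter_atTop hnull hanti
    ⟨0, measure_ne_top_of_subset (fun t ht => ht.1)
      (measure_Icc_lt_top (μ := volume) (a := (0:ℝ)) (b := 1)).ne⟩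
  rw [hempty, measure_empty] at hlim
  obtain ⟨n, hn⟩ := (hlim.eventually (gt_mem_nhds he)).exists
  exact ⟨n + 1, n.succ_pos, hn⟩

/-- The uniform Perron integrability, with measurable gauges, of a family of functions on `[0,1]`:
`c b` is the integral of `h b`. -/
def UnifPerron (h : B → ℝ → ℝ) (c : B → ℝ) : Prop :=
  ∀ ε > 0, ∃ δ : ℝ → ℝ, IsGauge δ ∧ AEMeasurable δ volume ∧
    ∀ (n : ℕ) (P : TP n), P.IsPerron → P.IsFine δ → ∀ b, |fSum P (h b) - c b| ≤ ε

/-- A pointwise bounded family of nonnegative functions that is uniformly Perron integrable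
has small total oscillation on the pieces of some countable partition. -/
theorem UnifPerron.exists_partition (h0 : ∀ b, ∀ t ∈ Icc (0:ℝ) 1, 0 ≤ h b t) {C : ℝ → ℝ}
    (hC : ∀ t ∈ Icc (0:ℝ) 1, ∀ b, h b t ≤ C t) (hint : UnifPerron h c) {ε : ℝ} (hε : 0 < ε) :
    ∃ (κ : ℝ → (ℕ × ℕ) ⊕ ℕ) (M : (ℕ × ℕ) ⊕ ℕ → ℝ) (lo hi : B → (ℕ × ℕ) ⊕ ℕ → ℝ),
      (∀ j, NullMeasurableSet {t | t ∈ Icc (0:ℝ) 1 ∧ κ t = j} volume) ∧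
      (∀ b, ∀ t ∈ Icc (0:ℝ) 1, lo b (κ t) ≤ h b t ∧ h b t ≤ hi b (κ t)) ∧
      (∀ b j, 0 ≤ lo b j ∧ lo b j ≤ hi b j ∧ hi b j ≤ M j) ∧
      ∀ (F : Finset ((ℕ × ℕ) ⊕ ℕ)) (b : B), ∑ j ∈ F,
        volume.real {t | t ∈ Icc (0:ℝ) 1 ∧ κ t = j} * (hi b j - lo b j) ≤ ε := by
  classical
  obtain ⟨e, he, ce, hce, hceε⟩ := posSumOfEncodable (half_pos hε) ℕ
  choose δ hδ hδm hδint using fun m => hint (e m) (he m)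
  choose N hN hNlt using fun m => (hδ m).exists_measure_lt (hδm m)
    (e := ((2:ℝ≥0∞)⁻¹) ^ m) (by simp [pos_iff_ne_zero])
  have hNR : ∀ m, (0:ℝ) < N m := fun m => Nat.cast_pos.2 (hN m)
  set E : ℕ → Set ℝ := fun m => {t | 1 / (N m : ℝ) < δ m t} with hE
  set cell : ℕ → ℝ → ℕ := fun m t => min ⌊t * N m⌋₊ (N m - 1) with hcell
  set κ : ℝ → (ℕ × ℕ) ⊕ ℕ := fun t =>
    if ht : ∃ m, t ∈ E m then Sum.inl (Nat.find ht, cell (Nat.find ht) t)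
    else Sum.inr ⌈C t⌉₊ with hκ
  set A : (ℕ × ℕ) ⊕ ℕ → Set ℝ := fun j => {t | t ∈ Icc (0:ℝ) 1 ∧ κ t = j} with hA
  have hAinl : ∀ m k, A (Sum.inl (m, k)) =
      (Icc (0:ℝ) 1 ∩ cell m ⁻¹' {k}) ∩ (E m \ ⋃ l ∈ Finset.range m, E l) := by
    intro m k
    ext t
    simp only [hA, hκ, mem_ofPred_eq, mem_inter_iff, mem_preimage, mem_singleton_iff, mem_sdiff,
      mem_iUnion, Finset.mem_range, exists_prop, not_exists, not_and]
    constructor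
    · rintro ⟨ht, h⟩
      split_ifs at h with hex
      simp only [Sum.inl.injEq, Prod.mk.injEq] at h
      obtain ⟨rfl, h2⟩ := h
      exact ⟨⟨ht, h2⟩, Nat.find_spec hex, fun l hl => Nat.find_min hex hl⟩
    · rintro ⟨⟨ht, h2⟩, h3, h4⟩
      have hex : ∃ m, t ∈ E m := ⟨m, h3⟩
      have hfind : Nat.find hex = m := (Nat.find_eq_iff hex).2 ⟨h3, h4⟩
      rw [dif_pos hex, hfind, h2]
      exact ⟨ht, rfl⟩
  have hAinr : ∀ k, volume (A (Sum.inr k)) = 0 := by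
    intro k
    have hsub : ∀ m, A (Sum.inr k) ⊆ {t | t ∈ Icc (0:ℝ) 1 ∧ δ m t ≤ 1 / N m} := by
      rintro m t ⟨ht, h⟩
      refine ⟨ht, not_lt.1 fun hlt => ?_⟩
      simp only [hκ] at h
      rw [dif_pos ⟨m, hlt⟩] at h
      cases h
    refine le_antisymm (ge_of_tendsto' (ENNReal.tendsto_pow_atTop_nhds_zero_of_lt_one
      (r := (2:ℝ≥0∞)⁻¹) (by simp)) fun m => ?_) bot_le
    exact (measure_mono (hsub m)).trans (hNlt m).le
  have hE0 : ∀ m, NullMeasurableSet (E m) volume := fun m =>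
    nullMeasurableSet_lt aemeasurable_const (hδm m)
  have hcellm : ∀ m, Measurable (cell m) := fun m =>
    (Nat.measurable_floor.comp (measurable_id.mul_const _)).min measurable_const
  have hAnull : ∀ j, NullMeasurableSet (A j) volume := by
    rintro (⟨m, k⟩ | k)
    · rw [hAinl]
      exact ((measurableSet_Icc.inter (hcellm m (measurableSet_singleton k))).nullMeasurableSet).inter
        ((hE0 m).diff (Finset.nullMeasurableSet_biUnion _ fun l _ => hE0 l))
    · exact NullMeasurableSet.of_null (hAinr k)
  have hAE : ∀ m k, A (Sum.inl (m, k)) ⊆ E m := fun m k t ht => by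
    rw [hAinl] at ht
    exact ht.2.1
  have hAcell : ∀ m k, ∀ t ∈ A (Sum.inl (m, k)), cell m t = k := fun m k t ht => by
    rw [hAinl] at ht
    exact ht.1.2
  have hAJ : ∀ m k, A (Sum.inl (m, k)) ⊆
      Icc ((k:ℝ) / N m) (((k + 1 : ℕ) : ℝ) / N m) := by
    intro m k t ht
    have h1 := hAcell m k t ht
    have ht0 : 0 ≤ t * N m := mul_nonneg ht.1.1 (hNR m).le
    rw [mem_Icc, div_le_iff₀ (hNR m), le_div_iff₀ (hNR m)]
    constructor
    · refine le_trans ?_ (Nat.floor_le ht0)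
      rw [← h1]
      exact_mod_cast min_le_left _ _
    · rcases min_choice ⌊t * N m⌋₊ (N m - 1) with h2 | h2
      · rw [← h1, hcell]
        simp only
        rw [h2]
        push_cast
        exact (Nat.lt_floor_add_one _).le
      · have h3 : k + 1 = N m := by
          have := hN m
          simp only [hcell] at h1
          omega
        rw [h3]
        exact mul_le_of_le_one_left (hNR m).le ht.1.2
  have hAN : ∀ m k, (A (Sum.inl (m, k))).Nonempty → k < N m := by
    rintro m k ⟨t, ht⟩
    have h1 := hAcell m k t ht
    have := hN m
    simp only [hcell] at h1
    omega
  have hbdd : ∀ j, ∃ M, 0 ≤ M ∧ ∀ b, ∀ t ∈ A j, h b t ≤ M := by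
    rintro (⟨m, k⟩ | k)
    · exact bddAbove_of_perron (hδ m) (hδint m) (hN m) (D := fun k => A (Sum.inl (m, k)))
        (hAJ m) (hAN m) (fun k t ht => hAE m k ht) (C := C) (fun k t ht b => hC t ht.1 b) k
    · refine ⟨k, Nat.cast_nonneg _, fun b t ht => (hC t ht.1 b).trans ((Nat.le_ceil _).trans ?_)⟩
      have h1 := ht.2
      simp only [hκ] at h1
      split_ifs at h1
      rw [Sum.inr.injEq] at h1
      rw [h1]
  choose M hM0 hM using hbdd
  have hbelow : ∀ b j, BddBelow (h b '' A j) := fun b j =>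
    ⟨0, by rintro _ ⟨t, ht, rfl⟩; exact h0 b t ht.1⟩
  have habove : ∀ b j, BddAbove (h b '' A j) := fun b j =>
    ⟨M j, by rintro _ ⟨t, ht, rfl⟩; exact hM j b t ht⟩
  have hlohi : ∀ b j, sInf (h b '' A j) ≤ sSup (h b '' A j) := fun b j =>
    Real.sInf_le_sSup _ (hbelow b j) (habove b j)
  refine ⟨κ, M, fun b j => sInf (h b '' A j), fun b j => sSup (h b '' A j), hAnull, ?_, ?_, ?_⟩
  · exact fun b t ht => ⟨csInf_le (hbelow b _) ⟨t, ⟨ht, rfl⟩, rfl⟩,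
      le_csSup (habove b _) ⟨t, ⟨ht, rfl⟩, rfl⟩⟩
  · refine fun b j => ⟨Real.sInf_nonneg ?_, hlohi b j, Real.sSup_le ?_ (hM0 j)⟩
    · rintro _ ⟨t, ht, rfl⟩
      exact h0 b t ht.1
    · rintro _ ⟨t, ht, rfl⟩
      exact hM j b t ht
  · intro F b
    set f : (ℕ × ℕ) ⊕ ℕ → ℝ := fun j =>
      volume.real (A j) * (sSup (h b '' A j) - sInf (h b '' A j)) with hf
    have hf0 : ∀ j, 0 ≤ f j := fun j =>
      mul_nonneg measureReal_nonneg (sub_nonneg.2 (hlohi b j))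
    have hinner : ∀ (m : ℕ) (K : Finset ℕ), ∑ k ∈ K, f (Sum.inl (m, k)) ≤ 2 * e m := by
      intro m K
      refine le_trans (Finset.sum_le_sum fun k _ => ?_) (sum_osc_le_of_perron (hδ m) (hδint m)
        (hN m) (D := fun k => A (Sum.inl (m, k))) (hAJ m) (hAN m) (fun k t ht => hAE m k ht) b K)
      refine mul_le_mul_of_nonneg_right ?_ (sub_nonneg.2 (hlohi b _))
      refine (measureReal_mono (hAJ m k) measure_Icc_lt_top.ne).trans (le_of_eq ?_)
      have hle : (k:ℝ) / N m ≤ ((k + 1 : ℕ) : ℝ) / N m := by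
        push_cast
        gcongr
        linarith
      rw [Real.volume_real_Icc_of_le hle]
      push_cast
      ring
    have hsplit : ∑ j ∈ F, f j = ∑ p ∈ F.toLeft, f (Sum.inl p) := by
      rw [← Finset.toLeft_disjSum_toRight (u := F), Finset.sum_disjSum,
        Finset.toLeft_disjSum]
      simp [hf, measureReal_def, hAinr]
    have hprod : F.toLeft ⊆ (F.toLeft.image Prod.fst) ×ˢ (F.toLeft.image Prod.snd) := fun p hp =>
      Finset.mem_product.2 ⟨Finset.mem_image_of_mem _ hp, Finset.mem_image_of_mem _ hp⟩
    calc ∑ j ∈ F, f j = ∑ p ∈ F.toLeft, f (Sum.inl p) := hsplit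
      _ ≤ ∑ p ∈ (F.toLeft.image Prod.fst) ×ˢ (F.toLeft.image Prod.snd), f (Sum.inl p) :=
          Finset.sum_le_sum_of_subset_of_nonneg hprod fun p _ _ => hf0 _
      _ = ∑ m ∈ F.toLeft.image Prod.fst, ∑ k ∈ F.toLeft.image Prod.snd, f (Sum.inl (m, k)) :=
          Finset.sum_product _ _ _
      _ ≤ ∑ m ∈ F.toLeft.image Prod.fst, 2 * e m := Finset.sum_le_sum fun m _ => hinner m _
      _ = 2 * ∑ m ∈ F.toLeft.image Prod.fst, e m := (Finset.mul_sum _ _ _).symm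
      _ ≤ 2 * ce := by
          gcongr
          exact sum_le_hasSum _ (fun m _ => (he m).le) hce
      _ ≤ ε := by linarith

/-- A measurable gauge for which the fine Riemann sums of a function that is bounded and constant on
the pieces of a countable partition are controlled by the measures of the pieces. -/
theorem exists_gauge_sum_bounds {ι : Type*} [Encodable ι] [DecidableEq ι] (κ : ℝ → ι)
    (hκ : ∀ j, NullMeasurableSet {t | t ∈ Icc (0:ℝ) 1 ∧ κ t = j} volume)
    {M : ι → ℝ} (hM : ∀ j, 0 ≤ M j) (F : Finset ι) {ε : ℝ} (hε : 0 < ε) :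
    ∃ δ : ℝ → ℝ, IsGauge δ ∧ AEMeasurable δ volume ∧ ∀ (n : ℕ) (P : TP n), P.IsFine δ →
      (∃ T : Finset ι, ∀ w : ι → ℝ, (∀ j, 0 ≤ w j) → (∀ j, w j ≤ M j) →
        ∑ i, P.len i * w (κ (P.tag i)) ≤
          ∑ j ∈ T, volume.real {t | t ∈ Icc (0:ℝ) 1 ∧ κ t = j} * w j + ε) ∧
      ∀ w : ι → ℝ, (∀ j, 0 ≤ w j) → (∀ j, w j ≤ M j) →
        ∑ j ∈ F, volume.real {t | t ∈ Icc (0:ℝ) 1 ∧ κ t = j} * w j - ε ≤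
          ∑ i, P.len i * w (κ (P.tag i)) := by
  set a : ι → ℝ := fun j => volume.real {t | t ∈ Icc (0:ℝ) 1 ∧ κ t = j} with ha
  obtain ⟨e, he, ce, hce, hceε⟩ := posSumOfEncodable hε ι
  have heT : ∀ T : Finset ι, ∑ j ∈ T, e j ≤ ε := fun T =>
    (sum_le_hasSum T (fun j _ => (he j).le) hce).trans hceε
  have hMF : 0 ≤ ∑ j ∈ F, M j := Finset.sum_nonneg fun j _ => hM j
  set η : ι → ℝ := fun j => e j / (1 + M j + ∑ j ∈ F, M j) with hη
  have hden : ∀ j, 0 < 1 + M j + ∑ j ∈ F, M j := fun j => by linarith [hM j]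
  have hηpos : ∀ j, 0 < η j := fun j => div_pos (he j) (hden j)
  have hηM : ∀ j, η j * M j ≤ e j := fun j => by
    rw [hη, div_mul_eq_mul_div, div_le_iff₀ (hden j)]
    exact mul_le_mul_of_nonneg_left (by linarith) (he j).le
  have hηF : ∀ j, η j * ∑ j ∈ F, M j ≤ e j := fun j => by
    rw [hη, div_mul_eq_mul_div, div_le_iff₀ (hden j)]
    exact mul_le_mul_of_nonneg_left (by linarith [hM j]) (he j).le
  have hasum : ∀ T : Finset ι, ∑ j ∈ T, a j ≤ 1 := by
    intro T
    have hfin : ∀ j ∈ T, volume {t | t ∈ Icc (0:ℝ) 1 ∧ κ t = j} ≠ ⊤ := fun j _ =>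
      measure_ne_top_of_subset (fun t ht => ht.1)
        (measure_Icc_lt_top (μ := volume) (a := (0:ℝ)) (b := 1)).ne
    have hdisj : (T : Set ι).Pairwise (Function.onFun (AEDisjoint volume)
        fun j => {t | t ∈ Icc (0:ℝ) 1 ∧ κ t = j}) := fun i _ j _ hij =>
      (Set.disjoint_left.2 fun t ht ht' => hij (ht.2.symm.trans ht'.2)).aedisjoint
    rw [ha, ← measureReal_biUnion_finset₀ hdisj (fun j _ => hκ j) hfin]
    refine (measureReal_mono (s₂ := Icc (0:ℝ) 1) (iUnion₂_subset fun j _ t ht => ht.1)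
      measure_Icc_lt_top.ne).trans (by simp)
  obtain ⟨δ, hδ, hδm, hδfib⟩ := exists_gauge_fiber κ hκ η hηpos
  refine ⟨δ, hδ, hδm, fun n P hP => ?_⟩
  set L : ι → ℝ := fun j => ∑ i with κ (P.tag i) = j, P.len i with hL
  have hL0 : ∀ j, 0 ≤ L j := fun j => Finset.sum_nonneg fun i _ => P.len_nonneg i
  have hLle : ∀ j, L j ≤ a j + η j := hδfib n P hP
  have hfib : ∀ (T : Finset ι) (w : ι → ℝ), (∀ i, κ (P.tag i) ∈ T) →
      ∑ i, P.len i * w (κ (P.tag i)) = ∑ j ∈ T, L j * w j := by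
    intro T w hT
    rw [← Finset.sum_fiberwise_of_maps_to (fun i _ => hT i)]
    refine Finset.sum_congr rfl fun j _ => ?_
    rw [hL, Finset.sum_mul]
    refine Finset.sum_congr rfl fun i hi => ?_
    rw [(Finset.mem_filter.1 hi).2]
  set T : Finset ι := Finset.univ.image fun i => κ (P.tag i) with hT
  have hmemT : ∀ i, κ (P.tag i) ∈ T := fun i => Finset.mem_image_of_mem _ (Finset.mem_univ i)
  refine ⟨⟨T, fun w hw0 hwM => ?_⟩, fun w hw0 hwM => ?_⟩
  · rw [hfib T w hmemT]
    calc ∑ j ∈ T, L j * w j ≤ ∑ j ∈ T, (a j * w j + e j) := by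
          refine Finset.sum_le_sum fun j _ => ?_
          calc L j * w j ≤ (a j + η j) * w j := mul_le_mul_of_nonneg_right (hLle j) (hw0 j)
            _ = a j * w j + η j * w j := add_mul _ _ _
            _ ≤ a j * w j + e j := by
              gcongr
              exact (mul_le_mul_of_nonneg_left (hwM j) (hηpos j).le).trans (hηM j)
      _ ≤ _ := by
          rw [Finset.sum_add_distrib]
          gcongr
          exact heT T
  · have hmem : ∀ i, κ (P.tag i) ∈ T ∪ F := fun i => Finset.mem_union_left _ (hmemT i)
    rw [hfib (T ∪ F) w hmem]
    have hL1 : ∑ j ∈ T ∪ F, L j = 1 := by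
      have := hfib (T ∪ F) (fun _ => 1) hmem
      simp only [mul_one] at this
      rw [← this, P.sum_len]
    have hlow : ∀ j ∈ F, a j - ∑ l ∈ T ∪ F, η l ≤ L j := by
      intro j hj
      have hj' : j ∈ T ∪ F := Finset.mem_union_right _ hj
      have h1 := Finset.add_sum_erase _ L hj'
      have h2 := Finset.add_sum_erase _ a hj'
      have h3 := Finset.add_sum_erase _ η hj'
      have h4 : ∑ l ∈ (T ∪ F).erase j, L l ≤ ∑ l ∈ (T ∪ F).erase j, (a l + η l) :=
        Finset.sum_le_sum fun l _ => hLle l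
      rw [Finset.sum_add_distrib] at h4
      linarith [hasum (T ∪ F), hηpos j]
    have hη0 : 0 ≤ ∑ l ∈ T ∪ F, η l := Finset.sum_nonneg fun l _ => (hηpos l).le
    have hsmall : (∑ l ∈ T ∪ F, η l) * ∑ j ∈ F, w j ≤ ε := by
      calc (∑ l ∈ T ∪ F, η l) * ∑ j ∈ F, w j ≤ (∑ l ∈ T ∪ F, η l) * ∑ j ∈ F, M j :=
            mul_le_mul_of_nonneg_left (Finset.sum_le_sum fun j _ => hwM j) hη0
        _ = ∑ l ∈ T ∪ F, η l * ∑ j ∈ F, M j := Finset.sum_mul _ _ _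
        _ ≤ ∑ l ∈ T ∪ F, e l := Finset.sum_le_sum fun l _ => hηF l
        _ ≤ ε := heT _
    calc ∑ j ∈ F, a j * w j - ε
        ≤ ∑ j ∈ F, a j * w j - (∑ l ∈ T ∪ F, η l) * ∑ j ∈ F, w j := by linarith
      _ = ∑ j ∈ F, (a j - ∑ l ∈ T ∪ F, η l) * w j := by
          simp only [sub_mul, Finset.sum_sub_distrib, Finset.mul_sum]
      _ ≤ ∑ j ∈ F, L j * w j :=
          Finset.sum_le_sum fun j hj => mul_le_mul_of_nonneg_right (hlow j hj) (hw0 j)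
      _ ≤ ∑ j ∈ T ∪ F, L j * w j :=
          Finset.sum_le_sum_of_subset_of_nonneg Finset.subset_union_right
            fun j _ _ => mul_nonneg (hL0 j) (hw0 j)

/-- For pointwise bounded families of nonnegative functions, uniform Perron integrability with
measurable gauges implies uniform McShane integrability with measurable gauges. -/
theorem UnifPerron.mcShane (h0 : ∀ b, ∀ t ∈ Icc (0:ℝ) 1, 0 ≤ h b t) {C : ℝ → ℝ}
    (hC : ∀ t ∈ Icc (0:ℝ) 1, ∀ b, h b t ≤ C t) (hint : UnifPerron h c) {ε : ℝ} (hε : 0 < ε) :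
    ∃ δ : ℝ → ℝ, IsGauge δ ∧ AEMeasurable δ volume ∧
      ∀ (n : ℕ) (P : TP n), P.IsFine δ → ∀ b, |fSum P (h b) - c b| ≤ ε := by
  classical
  have hε' : 0 < ε / 4 := by positivity
  obtain ⟨κ, M, lo, hi, hκ, hbd, hlohi, hosc⟩ := hint.exists_partition h0 hC hε'
  obtain ⟨δ₀, hδ₀, hδ₀m, hδ₀int⟩ := hint (ε / 4) hε'
  rcases isEmpty_or_nonempty B with hB | ⟨⟨b₀⟩⟩
  · exact ⟨δ₀, hδ₀, hδ₀m, fun n P _ b => hB.elim b⟩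
  have hM : ∀ j, 0 ≤ M j := fun j =>
    (hlohi b₀ j).1.trans ((hlohi b₀ j).2.1.trans (hlohi b₀ j).2.2)
  have hlo0 : ∀ b j, 0 ≤ lo b j := fun b j => (hlohi b j).1
  have hloM : ∀ b j, lo b j ≤ M j := fun b j => (hlohi b j).2.1.trans (hlohi b j).2.2
  have hhi0 : ∀ b j, 0 ≤ hi b j := fun b j => (hlo0 b j).trans (hlohi b j).2.1
  have hhiM : ∀ b j, hi b j ≤ M j := fun b j => (hlohi b j).2.2
  have hlow : ∀ (n : ℕ) (P : TP n) (b : B),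
      ∑ i, P.len i * lo b (κ (P.tag i)) ≤ fSum P (h b) := fun n P b =>
    Finset.sum_le_sum fun i _ =>
      mul_le_mul_of_nonneg_left (hbd b _ (P.tagMem i)).1 (P.len_nonneg i)
  have hupp : ∀ (n : ℕ) (P : TP n) (b : B),
      fSum P (h b) ≤ ∑ i, P.len i * hi b (κ (P.tag i)) := fun n P b =>
    Finset.sum_le_sum fun i _ =>
      mul_le_mul_of_nonneg_left (hbd b _ (P.tagMem i)).2 (P.len_nonneg i)
  have hosc' : ∀ (F : Finset ((ℕ × ℕ) ⊕ ℕ)) (b : B),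
      ∑ j ∈ F, volume.real {t | t ∈ Icc (0:ℝ) 1 ∧ κ t = j} * hi b j ≤
        ∑ j ∈ F, volume.real {t | t ∈ Icc (0:ℝ) 1 ∧ κ t = j} * lo b j + ε / 4 := by
    intro F b
    have := hosc F b
    simp only [mul_sub, Finset.sum_sub_distrib] at this
    linarith
  have hF : ∀ (F : Finset ((ℕ × ℕ) ⊕ ℕ)) (b : B),
      ∑ j ∈ F, volume.real {t | t ∈ Icc (0:ℝ) 1 ∧ κ t = j} * lo b j ≤ c b + ε / 2 := by
    intro F b
    obtain ⟨δ, hδ, -, hδs⟩ := exists_gauge_sum_bounds κ hκ hM F hε'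
    obtain ⟨n, P, hP, hPf⟩ := (hδ.min hδ₀).exists_perron
    have h1 := (hδs n P (hPf.mono fun t => min_le_left _ _)).2 (lo b) (hlo0 b) (hloM b)
    have h2 := (abs_le.1 (hδ₀int n P hP (hPf.mono fun t => min_le_right _ _) b)).2
    linarith [hlow n P b]
  obtain ⟨T, hT⟩ : ∃ T : Finset ((ℕ × ℕ) ⊕ ℕ), ∀ b,
      c b - 3 * (ε / 4) ≤
        ∑ j ∈ T, volume.real {t | t ∈ Icc (0:ℝ) 1 ∧ κ t = j} * lo b j := by
    obtain ⟨δ, hδ, -, hδs⟩ := exists_gauge_sum_bounds κ hκ hM ∅ hε'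
    obtain ⟨n, P, hP, hPf⟩ := (hδ.min hδ₀).exists_perron
    obtain ⟨T, hT⟩ := (hδs n P (hPf.mono fun t => min_le_left _ _)).1
    refine ⟨T, fun b => ?_⟩
    have h1 := hT (hi b) (hhi0 b) (hhiM b)
    have h2 := (abs_le.1 (hδ₀int n P hP (hPf.mono fun t => min_le_right _ _) b)).1
    linarith [hupp n P b, hosc' T b]
  obtain ⟨δ, hδ, hδm, hδs⟩ := exists_gauge_sum_bounds κ hκ hM T hε'
  refine ⟨δ, hδ, hδm, fun n P hP b => ?_⟩
  obtain ⟨⟨K, hK⟩, hlo⟩ := hδs n P hP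
  have h1 := hK (hi b) (hhi0 b) (hhiM b)
  have h2 := hlo (lo b) (hlo0 b) (hloM b)
  rw [abs_le]
  constructor
  · linarith [hT b, hlow n P b]
  · linarith [hosc' K b, hF K b, hupp n P b]

/-! ### Strongly exposed points of weakly compact convex sets -/

theorem continuous_weakSpace_apply (y : X →L[ℝ] ℝ) :
    Continuous fun x : WeakSpace ℝ X => y ((toWeakSpace ℝ X).symm x) :=
  WeakBilin.eval_continuous (topDualPairing ℝ X).flip y

theorem exists_forall_le_of_isCompact_weak {C : Set X} (hne : C.Nonempty)
    (hC : IsCompact (toWeakSpace ℝ X '' C)) (y : X →L[ℝ] ℝ) :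
    ∃ z ∈ C, ∀ w ∈ C, y w ≤ y z := by
  obtain ⟨_, ⟨z, hz, rfl⟩, hmax⟩ :=
    hC.exists_isMaxOn (hne.image _) (continuous_weakSpace_apply y).continuousOn
  refine ⟨z, hz, fun w hw => ?_⟩
  simpa using hmax (mem_image_of_mem _ hw)

theorem isCompact_weak_inter {C Z : Set X} (hC : IsCompact (toWeakSpace ℝ X '' C))
    (hZ : Convex ℝ Z) (hZc : IsClosed Z) : IsCompact (toWeakSpace ℝ X '' (C ∩ Z)) := by
  rw [image_inter (toWeakSpace ℝ X).injective]
  refine hC.inter_right ?_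
  rw [← hZc.closure_eq, hZ.toWeakSpace_closure ℝ]
  exact isClosed_closure

theorem exists_norm_le_of_isCompact_weak {C : Set X}
    (hC : IsCompact (toWeakSpace ℝ X '' C)) : ∃ M > 0, ∀ x ∈ C, ‖x‖ ≤ M := by
  have hpt : ∀ y : X →L[ℝ] ℝ, ∃ K, ∀ x : C,
      ‖NormedSpace.inclusionInDoubleDual ℝ X (x : X) y‖ ≤ K := by
    intro y
    obtain ⟨K, hK⟩ := (hC.image (continuous_weakSpace_apply y)).isBounded.exists_norm_le
    refine ⟨K, fun x => ?_⟩
    simpa using hK _ (mem_image_of_mem _ (mem_image_of_mem _ x.2))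
  obtain ⟨K, hK⟩ := banach_steinhaus hpt
  refine ⟨max K 1, by positivity, fun x hx => ?_⟩
  rw [← (NormedSpace.inclusionInDoubleDualLi ℝ (E := X)).norm_map x]
  exact (hK ⟨x, hx⟩).trans (le_max_left _ _)

/-- The set of maximizers of `y` on `I`. -/
def maximizers (I : Set X) (y : X →L[ℝ] ℝ) : Set X := {z | z ∈ I ∧ ∀ w ∈ I, y w ≤ y z}

theorem isClosed_setOf_maximizers_inter {I C : Set X} {M : ℝ} (hM : 0 < M)
    (hI : ∀ x ∈ I, ‖x‖ ≤ M) (hC : IsCompact (toWeakSpace ℝ X '' (I ∩ C))) :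
    IsClosed {y : X →L[ℝ] ℝ | (maximizers I y ∩ C).Nonempty} := by
  refine isClosed_of_closure_subset fun y hy => ?_
  have hne : (I ∩ C).Nonempty := by
    obtain ⟨y', z, hz, hzC⟩ := closure_nonempty_iff.1 ⟨y, hy⟩
    exact ⟨z, hz.1, hzC⟩
  obtain ⟨z, hz, hmax⟩ := exists_forall_le_of_isCompact_weak hne hC y
  refine ⟨z, ⟨hz.1, fun w hw => le_of_forall_pos_le_add fun ε hε => ?_⟩, hz.2⟩
  obtain ⟨y', ⟨z', hz', hzC'⟩, hdist⟩ := Metric.mem_closure_iff.1 hy (ε / (2 * M)) (by positivity)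
  have key : ∀ x ∈ I, |y x - y' x| ≤ ε / 2 := by
    intro x hx
    calc |y x - y' x| = ‖(y - y') x‖ := by simp
      _ ≤ ‖y - y'‖ * ‖x‖ := (y - y').le_opNorm x
      _ ≤ ε / (2 * M) * M := by
        rw [dist_eq_norm] at hdist
        have := hI x hx
        gcongr
      _ = ε / 2 := by field_simp
  have h1 := abs_le.1 (key w hw)
  have h2 := abs_le.1 (key z' hz'.1)
  have h3 := hz'.2 w hw
  have h4 := hmax z' ⟨hz'.1, hzC'⟩
  linarith [h1.2, h2.1]

/-- The functionals near which the maximizers on `I` vary by at most `ε`. -/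
def smallMaximizers (I : Set X) (ε : ℝ) : Set (X →L[ℝ] ℝ) :=
  {v | ∃ r > 0, ∀ v₁ ∈ ball v r, ∀ v₂ ∈ ball v r, ∀ z₁ ∈ maximizers I v₁,
    ∀ z₂ ∈ maximizers I v₂, ‖z₁ - z₂‖ ≤ ε}

theorem isOpen_smallMaximizers (I : Set X) (ε : ℝ) : IsOpen (smallMaximizers I ε) := by
  rw [Metric.isOpen_iff]
  rintro v ⟨r, hr, h⟩
  refine ⟨r / 2, by positivity, fun u hu => ⟨r / 2, by positivity, ?_⟩⟩
  have hsub : ball u (r / 2) ⊆ ball v r := by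
    refine ball_subset_ball' ?_
    have := mem_ball.1 hu
    linarith
  exact fun v₁ h₁ v₂ h₂ => h v₁ (hsub h₁) v₂ (hsub h₂)

theorem exists_norm_le_one_apply_eq (x : X) : ∃ φ : X →L[ℝ] ℝ, ‖φ‖ ≤ 1 ∧ φ x = ‖x‖ := by
  obtain ⟨φ, h1, h2⟩ := exists_dual_vector'' ℝ x
  exact ⟨φ, h1, by simpa using h2⟩

theorem exists_countable_stable {α ι : Type*} [Countable ι] (op : ι → α → α) (a : α) :
    ∃ S : Set α, S.Countable ∧ a ∈ S ∧ ∀ q, ∀ y ∈ S, op q y ∈ S := by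
  refine ⟨range fun l : List ι => l.foldr op a, countable_range _, ⟨[], rfl⟩, ?_⟩
  rintro q _ ⟨l, rfl⟩
  exact ⟨q :: l, rfl⟩

theorem exists_countable_maximizers_inter {I : Set X} (hI : IsCWK X I)
    {Y₀ : Set (X →L[ℝ] ℝ)} (hY₀ : Y₀.Countable) {ε : ℝ} (hε : 0 < ε) :
    ∃ c : Set X, c.Countable ∧
      ∀ y ∈ closure Y₀, ∃ k ∈ c, (maximizers I y ∩ closedBall k ε).Nonempty := by
  obtain ⟨M, hM, hIM⟩ := exists_norm_le_of_isCompact_weak hI.2.2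
  choose s hsI hs using exists_forall_le_of_isCompact_weak hI.1 hI.2.2
  let Z : Submodule ℝ X := (Submodule.span ℝ (s '' Y₀)).topologicalClosure
  have hZc : IsClosed (Z : Set X) := Submodule.isClosed_topologicalClosure _
  have hsZ : ∀ y ∈ Y₀, s y ∈ Z := fun y hy =>
    Submodule.le_topologicalClosure _ (Submodule.subset_span (mem_image_of_mem s hy))
  have hclosed := isClosed_setOf_maximizers_inter (C := Z) hM hIM
    (isCompact_weak_inter hI.2.2 Z.convex hZc)
  have hsub : Y₀ ⊆ {y : X →L[ℝ] ℝ | (maximizers I y ∩ Z).Nonempty} :=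
    fun y hy => ⟨s y, ⟨hsI y, hs y⟩, hsZ y hy⟩
  obtain ⟨c, hc, hZsub⟩ : TopologicalSpace.IsSeparable (Z : Set X) := by
    have : TopologicalSpace.IsSeparable (s '' Y₀) := (hY₀.image s).isSeparable
    exact (this.span (R := ℝ)).closure
  refine ⟨c, hc, fun y hy => ?_⟩
  obtain ⟨z, hz, hzZ⟩ := closure_minimal hsub hclosed hy
  obtain ⟨k, hk, hzk⟩ := Metric.mem_closure_iff.1 (hZsub hzZ) ε hε
  exact ⟨k, hk, z, hz, hzk.le⟩

theorem exists_ball_maximizers_inter {I : Set X} (hI : IsCWK X I)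
    {Y₀ : Set (X →L[ℝ] ℝ)} (hY₀ : Y₀.Countable) {V : Set (X →L[ℝ] ℝ)} (hV : IsOpen V)
    (hne : (Y₀ ∩ V).Nonempty) {ε : ℝ} (hε : 0 < ε) :
    ∃ v ∈ Y₀ ∩ V, ∃ ρ > 0, ∃ k : X, ∀ y ∈ Y₀ ∩ ball v ρ,
      (maximizers I y ∩ closedBall k ε).Nonempty := by
  obtain ⟨M, hM, hIM⟩ := exists_norm_le_of_isCompact_weak hI.2.2
  obtain ⟨c, hc, hcov⟩ := exists_countable_maximizers_inter hI hY₀ hε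
  let T : X → Set (closure Y₀) := fun k =>
    (↑) ⁻¹' {y : X →L[ℝ] ℝ | (maximizers I y ∩ closedBall k ε).Nonempty}
  have hT : ∀ k ∈ c, IsClosed (T k) := fun k _ =>
    (isClosed_setOf_maximizers_inter hM hIM (isCompact_weak_inter hI.2.2
      (convex_closedBall k ε) isClosed_closedBall)).preimage continuous_subtype_val
  have hcover : ⋃ k ∈ c, T k = univ := by
    refine eq_univ_of_forall fun y => ?_
    obtain ⟨k, hk, hyk⟩ := hcov y y.2
    exact mem_biUnion hk hyk
  have : CompleteSpace (closure Y₀) := isClosed_closure.completeSpace_coe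
  have hbaire := dense_biUnion_interior_of_closed hT hc hcover
  obtain ⟨u, huY, huV⟩ := hne
  obtain ⟨y, hyV, hy⟩ := hbaire.inter_open_nonempty _
    (hV.preimage (continuous_subtype_val (p := (· ∈ closure Y₀))))
    ⟨⟨u, subset_closure huY⟩, huV⟩
  simp only [mem_iUnion] at hy
  obtain ⟨k, -, hyk⟩ := hy
  obtain ⟨U, hU, hUk⟩ := isOpen_induced_iff.1 (isOpen_interior (s := T k))
  have hyU : (y : X →L[ℝ] ℝ) ∈ U := by
    rw [← hUk] at hyk
    exact hyk
  obtain ⟨v, ⟨hvU, hvV⟩, hvY⟩ := _root_.mem_closure_iff.1 y.2 _ (hU.inter hV) ⟨hyU, hyV⟩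
  obtain ⟨ρ, hρ, hsub⟩ := Metric.isOpen_iff.1 hU v hvU
  refine ⟨v, ⟨hvY, hvV⟩, ρ, hρ, k, fun w hw => ?_⟩
  have hwT : (⟨w, subset_closure hw.1⟩ : closure Y₀) ∈ interior (T k) := by
    rw [← hUk]
    exact hsub hw.2
  exact (interior_subset hwT : _ ∈ T k)

theorem dense_smallMaximizers {I : Set X} (hI : IsCWK X I) {ε : ℝ} (hε : 0 < ε) :
    Dense (smallMaximizers I ε) := by
  by_contra hdense
  obtain ⟨u₀, ρ, hρ, hempty⟩ : ∃ u₀ : X →L[ℝ] ℝ, ∃ ρ > 0,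
      ∀ y ∈ ball u₀ ρ, y ∉ smallMaximizers I ε := by
    rw [Metric.dense_iff] at hdense
    push Not at hdense
    obtain ⟨u₀, ρ, hρ, h⟩ := hdense
    exact ⟨u₀, ρ, hρ, fun y hy hy' => h.subset ⟨hy, hy'⟩⟩
  have hbad : ∀ (y : X →L[ℝ] ℝ) (n : ℕ), ∃ v₁ v₂ φ : X →L[ℝ] ℝ, y ∈ ball u₀ ρ →
      ‖φ‖ ≤ 1 ∧ v₁ ∈ ball y (1 / (n + 1 : ℝ)) ∧ v₂ ∈ ball y (1 / (n + 1 : ℝ)) ∧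
      ∃ z₁ ∈ maximizers I v₁, ∃ z₂ ∈ maximizers I v₂, ε < φ (z₁ - z₂) := by
    intro y n
    by_cases hy : y ∈ ball u₀ ρ
    · have := hempty y hy
      simp only [smallMaximizers, mem_ofPred_eq, not_exists, not_and, not_forall, not_le] at this
      obtain ⟨v₁, h₁, v₂, h₂, z₁, hz₁, z₂, hz₂, hlt⟩ := this (1 / (n + 1 : ℝ)) (by positivity)
      obtain ⟨φ, hφ, hφz⟩ := exists_norm_le_one_apply_eq (z₁ - z₂)
      exact ⟨v₁, v₂, φ, fun _ => ⟨hφ, h₁, h₂, z₁, hz₁, z₂, hz₂, hφz ▸ hlt⟩⟩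
    · exact ⟨0, 0, 0, fun h => (hy h).elim⟩
  choose v₁ v₂ φ hvφ using hbad
  obtain ⟨Y₀, hY₀, hu₀, hop⟩ := exists_countable_stable (fun (q : ℕ × Bool) y =>
    if q.2 then v₁ y q.1 + (1 / (q.1 + 1 : ℝ)) • φ y q.1
    else v₂ y q.1 - (1 / (q.1 + 1 : ℝ)) • φ y q.1) u₀
  obtain ⟨v, ⟨hvY, hvV⟩, ρ', hρ', k, hk⟩ := exists_ball_maximizers_inter hI hY₀ isOpen_ball
    ⟨u₀, hu₀, mem_ball_self hρ⟩ (half_pos hε)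
  obtain ⟨n, hn⟩ := exists_nat_one_div_lt (half_pos hρ')
  obtain ⟨hφ, hv₁, hv₂, z₁, hz₁, z₂, hz₂, hlt⟩ := hvφ v n hvV
  have hm₁ := hop (n, true) v hvY
  have hm₂ := hop (n, false) v hvY
  simp only [if_true, Bool.false_eq_true, if_false] at hm₁ hm₂
  have hr0 : 0 < 1 / (n + 1 : ℝ) := by positivity
  generalize 1 / (n + 1 : ℝ) = r at *
  generalize v₁ v n = y₁ at *
  generalize v₂ v n = y₂ at *
  generalize φ v n = ψ at *
  have hrφ : ‖r • ψ‖ ≤ r := by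
    rw [norm_smul, Real.norm_of_nonneg hr0.le]
    exact mul_le_of_le_one_right hr0.le hφ
  rw [mem_ball, dist_eq_norm] at hv₁ hv₂
  obtain ⟨z, hz, hzk⟩ := hk (y₁ + r • ψ) ⟨hm₁, by
    rw [mem_ball, dist_eq_norm, add_sub_right_comm]
    linarith [norm_add_le (y₁ - v) (r • ψ)]⟩
  obtain ⟨z', hz', hzk'⟩ := hk (y₂ - r • ψ) ⟨hm₂, by
    rw [mem_ball, dist_eq_norm, sub_right_comm]
    linarith [norm_sub_le (y₂ - v) (r • ψ)]⟩
  have e₁ : y₁ z₁ + r * ψ z₁ ≤ y₁ z + r * ψ z := by simpa using hz.2 z₁ hz₁.1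
  have e₂ : y₂ z₂ - r * ψ z₂ ≤ y₂ z' - r * ψ z' := by simpa using hz'.2 z₂ hz₂.1
  have f₁ : ψ z₁ ≤ ψ z := le_of_mul_le_mul_left (by linarith [hz₁.2 z hz.1]) hr0
  have f₂ : ψ z' ≤ ψ z₂ := le_of_mul_le_mul_left (by linarith [hz₂.2 z' hz'.1]) hr0
  have hle : ψ (z - z') ≤ ‖z - z'‖ := by
    refine (le_abs_self _).trans ((ψ.le_opNorm _).trans ?_)
    exact mul_le_of_le_one_left (norm_nonneg _) hφ
  have hzz : ‖z - z'‖ ≤ ε := by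
    rw [← dist_eq_norm]
    linarith [dist_triangle_right z z' k, mem_closedBall.1 hzk, mem_closedBall.1 hzk']
  rw [map_sub] at hlt hle
  linarith

/-- A weakly compact convex set has a strongly exposed point. -/
theorem IsCWK.exists_strongly_exposed {I : Set X} (hI : IsCWK X I) :
    ∃ x ∈ I, ∃ v : X →L[ℝ] ℝ, (∀ z ∈ I, v z ≤ v x) ∧
      ∀ ε > 0, ∃ α > 0, ∀ z ∈ I, v x - α < v z → ‖z - x‖ < ε := by
  have hD : Dense (⋂ n : ℕ, smallMaximizers I (1 / (n + 1 : ℝ))) :=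
    dense_iInter_of_isOpen (fun n => isOpen_smallMaximizers I _)
      fun n => dense_smallMaximizers hI (by positivity)
  obtain ⟨v, hv⟩ := hD.nonempty
  obtain ⟨x, hx, hmax⟩ := exists_forall_le_of_isCompact_weak hI.1 hI.2.2 v
  refine ⟨x, hx, v, hmax, fun ε hε => ?_⟩
  obtain ⟨n, hn⟩ := exists_nat_one_div_lt (half_pos hε)
  obtain ⟨r, hr, hosc⟩ := mem_iInter.1 hv n
  set η : ℝ := 1 / (n + 1 : ℝ) with hη
  have hη0 : 0 < η := by positivity
  refine ⟨r / 2 * η, by positivity, fun z hz hzα => ?_⟩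
  by_contra! hfar
  obtain ⟨φ, hφ, hφz⟩ := exists_norm_le_one_apply_eq (z - x)
  have hball : v + (r / 2) • φ ∈ ball v r := by
    rw [mem_ball, dist_eq_norm, add_sub_cancel_left, norm_smul, Real.norm_of_nonneg (by positivity)]
    nlinarith
  obtain ⟨w, hw, hwmax⟩ := exists_forall_le_of_isCompact_weak hI.1 hI.2.2 (v + (r / 2) • φ)
  have hwx := hosc _ hball v (mem_ball_self hr) w ⟨hw, hwmax⟩ x ⟨hx, hmax⟩
  have h1 : v z + r / 2 * φ z ≤ v w + r / 2 * φ w := by simpa using hwmax z hz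
  have h2 := hmax w hw
  have hle : φ (w - x) ≤ η := by
    refine (le_abs_self _).trans (((φ).le_opNorm _).trans ?_)
    exact (mul_le_of_le_one_left (norm_nonneg _) hφ).trans hwx
  rw [map_sub] at hle hφz
  have h3 : r / 2 * (φ z - φ x) < r / 2 * (2 * η) := by nlinarith
  have h4 := lt_of_mul_lt_mul_left h3 (by positivity)
  linarith

/-! ### Support functions and the Hausdorff distance -/

open Bornology

theorem IsCWK.isBounded {A : Set X} (hA : IsCWK X A) : IsBounded A := by
  obtain ⟨M, -, hM⟩ := exists_norm_le_of_isCompact_weak hA.2.2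
  exact isBounded_iff_forall_norm_le.2 ⟨M, hM⟩

theorem bddAbove_image_of_isBounded {A : Set X} (hA : IsBounded A) (y : X →L[ℝ] ℝ) :
    BddAbove (y '' A) :=
  (y.lipschitz.isBounded_image hA).bddAbove

theorem le_suppFn {A : Set X} (hA : IsBounded A) (y : X →L[ℝ] ℝ) {x : X} (hx : x ∈ A) :
    y x ≤ suppFn y A :=
  le_csSup (bddAbove_image_of_isBounded hA y) (mem_image_of_mem y hx)

theorem suppFn_le {A : Set X} (hne : A.Nonempty) (y : X →L[ℝ] ℝ) {K : ℝ}
    (h : ∀ x ∈ A, y x ≤ K) : suppFn y A ≤ K :=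
  csSup_le (hne.image y) (forall_mem_image.2 h)

theorem suppFn_add {A B : Set X} (hA : A.Nonempty) (hB : B.Nonempty) (hA' : IsBounded A)
    (hB' : IsBounded B) (y : X →L[ℝ] ℝ) : suppFn y (A + B) = suppFn y A + suppFn y B := by
  rw [suppFn, image_add, csSup_add (hA.image y) (bddAbove_image_of_isBounded hA' y) (hB.image y)
    (bddAbove_image_of_isBounded hB' y)]
  rfl

theorem suppFn_smul (A : Set X) {r : ℝ} (hr : 0 ≤ r) (y : X →L[ℝ] ℝ) :
    suppFn y (r • A) = r * suppFn y A := by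
  rw [suppFn, image_smul_comm y r A fun x => map_smul y r x, Real.sSup_smul_of_nonneg hr]
  rfl

theorem suppFn_singleton (x : X) (y : X →L[ℝ] ℝ) : suppFn y {x} = y x := by
  simp [suppFn]

theorem suppFn_le_add_hausdorffDist {A B : Set X} (hA : A.Nonempty) (hB : B.Nonempty)
    (hA' : IsBounded A) (hB' : IsBounded B) {y : X →L[ℝ] ℝ} (hy : ‖y‖ ≤ 1) :
    suppFn y A ≤ suppFn y B + hausdorffDist A B := by
  refine suppFn_le hA y fun x hx => le_of_forall_pos_le_add fun ε hε => ?_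
  obtain ⟨b, hb, hxb⟩ := exists_dist_lt_of_hausdorffDist_lt hx (lt_add_of_pos_right _ hε)
    (hausdorffEDist_ne_top_of_nonempty_of_bounded hA hB hA' hB')
  have h1 : y x - y b ≤ ‖x - b‖ := by
    rw [← map_sub]
    exact (le_abs_self _).trans
      ((y.le_opNorm _).trans (mul_le_of_le_one_left (norm_nonneg _) hy))
  rw [dist_eq_norm] at hxb
  linarith [le_suppFn hB' y hb]

theorem abs_suppFn_sub_le {A B : Set X} (hA : A.Nonempty) (hB : B.Nonempty)
    (hA' : IsBounded A) (hB' : IsBounded B) {y : X →L[ℝ] ℝ} (hy : ‖y‖ ≤ 1) :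
    |suppFn y A - suppFn y B| ≤ hausdorffDist A B := by
  have h1 := suppFn_le_add_hausdorffDist hA hB hA' hB' hy
  have h2 := suppFn_le_add_hausdorffDist hB hA hB' hA' hy
  rw [hausdorffDist_comm] at h2
  exact abs_le.2 ⟨by linarith, by linarith⟩

theorem infDist_le_of_suppFn_le {A B : Set X} (hB : B.Nonempty) (hA' : IsBounded A)
    (hBc : Convex ℝ B) {c : ℝ} (hc : 0 ≤ c)
    (h : ∀ y : X →L[ℝ] ℝ, ‖y‖ ≤ 1 → suppFn y A ≤ suppFn y B + c) {x : X} (hx : x ∈ A) :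
    infDist x B ≤ c := by
  by_contra! hlt
  obtain ⟨s, hcs, hs⟩ := exists_between hlt
  have hs0 : 0 < s := hc.trans_lt hcs
  have hdisj : Disjoint (ball x (infDist x B)) B := disjoint_ball_infDist
  obtain ⟨f, u, hfu, huf⟩ :=
    geometric_hahn_banach_open (convex_ball x (infDist x B)) isOpen_ball hBc hdisj
  have hfx : f x < u := hfu x (mem_ball_self (hs0.trans hs))
  have hnorm : ‖f‖ ≤ (u - f x) / s := by
    refine ContinuousLinearMap.opNorm_le_of_unit_norm (div_nonneg (by linarith) hs0.le)
      fun z hz => ?_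
    have h1 : f x + s * f z < u := by
      simpa using hfu (x + s • z) (by simpa [norm_smul, hz, abs_of_pos hs0] using hs)
    have h2 : f x - s * f z < u := by
      simpa using hfu (x - s • z) (by simpa [dist_eq_norm, norm_smul, hz, abs_of_pos hs0] using hs)
    rw [le_div_iff₀ hs0, Real.norm_eq_abs]
    rcases abs_cases (f z) with ⟨h, -⟩ | ⟨h, -⟩ <;> rw [h] <;> linarith
  rw [le_div_iff₀ hs0] at hnorm
  have hf0 : 0 < ‖f‖ := by
    obtain ⟨b, hb⟩ := hB
    refine norm_pos_iff.2 ?_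
    rintro rfl
    have := huf b hb
    simp at this hfx
    linarith
  have hg : ‖(-‖f‖⁻¹) • f‖ ≤ 1 := by
    rw [norm_smul, norm_neg, norm_inv, norm_norm, inv_mul_cancel₀ hf0.ne']
  have h1 := h _ hg
  have h2 := le_suppFn hA' ((-‖f‖⁻¹) • f) hx
  have h3 : suppFn ((-‖f‖⁻¹) • f) B ≤ ((-‖f‖⁻¹) • f) x - s := by
    refine suppFn_le hB _ fun b hb => ?_
    have h4 : ‖f‖ * s ≤ f b - f x := by linarith [huf b hb]
    have h5 : s ≤ ‖f‖⁻¹ * (f b - f x) := by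
      rwa [le_inv_mul_iff₀ hf0]
    simp only [smul_apply, smul_eq_mul]
    linarith
  linarith

theorem hausdorffDist_le_of_suppFn {A B : Set X} (hA : A.Nonempty) (hB : B.Nonempty)
    (hA' : IsBounded A) (hB' : IsBounded B) (hAc : Convex ℝ A) (hBc : Convex ℝ B) {c : ℝ}
    (hc : 0 ≤ c) (h : ∀ y : X →L[ℝ] ℝ, ‖y‖ ≤ 1 → |suppFn y A - suppFn y B| ≤ c) :
    hausdorffDist A B ≤ c := by
  refine hausdorffDist_le_of_infDist hc (fun x hx => ?_) (fun x hx => ?_)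
  · exact infDist_le_of_suppFn_le hB hA' hBc hc
      (fun y hy => by linarith [(abs_le.1 (h y hy)).2]) hx
  · exact infDist_le_of_suppFn_le hA hB' hAc hc
      (fun y hy => by linarith [(abs_le.1 (h y hy)).1]) hx

theorem IsCWK.add_singleton {A : Set X} (hA : IsCWK X A) (x : X) : IsCWK X (A + {x}) := by
  refine ⟨hA.1.add (singleton_nonempty x), hA.2.1.add (convex_singleton x), ?_⟩
  have : toWeakSpace ℝ X '' (A + {x}) = (· + toWeakSpace ℝ X x) '' (toWeakSpace ℝ X '' A) := by
    rw [image_add]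
    simp
  rw [this]
  exact hA.2.2.image (continuous_id.add continuous_const)

theorem sub_singleton_eq {G : Type*} [AddCommGroup G] (A : Set G) (x : G) : A - {x} = A + {-x} := by
  rw [sub_eq_add_neg, neg_singleton]

theorem sub_singleton_add_cancel {G : Type*} [AddCommGroup G] (A : Set G) (x : G) :
    A - {x} + {x} = A := by
  rw [sub_singleton_eq, add_assoc, singleton_add_singleton, neg_add_cancel,
    singleton_zero, add_zero]

/-! ### Riemann sums of multifunctions -/

theorem mSum_nonempty {n : ℕ} (P : TP n) {Γ : ℝ → Set X}
    (h : ∀ t ∈ Icc (0:ℝ) 1, (Γ t).Nonempty) : (mSum P Γ).Nonempty := by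
  choose g hg using fun i => h _ (P.tagMem i)
  exact ⟨_, finsetSum_mem_finsetSum _ _ _ fun i _ => smul_mem_smul_set (hg i)⟩

theorem fSum_mem_mSum {n : ℕ} (P : TP n) {Γ : ℝ → Set X} {f : ℝ → X} (hf : Selection Γ f) :
    fSum P f ∈ mSum P Γ :=
  finsetSum_mem_finsetSum _ _ _ fun i _ => smul_mem_smul_set (hf _ (P.tagMem i))

theorem isBounded_finset_sum {ι E : Type*} [SeminormedAddCommGroup E] (s : Finset ι)
    {A : ι → Set E}
    (h : ∀ i ∈ s, IsBounded (A i)) : IsBounded (∑ i ∈ s, A i) := by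
  classical
  induction s using Finset.induction_on with
  | empty => simpa only [Finset.sum_empty, singleton_zero] using isBounded_singleton (x := (0 : E))
  | insert a s ha ih =>
    rw [Finset.sum_insert ha]
    exact (h a (by simp)).add (ih fun i hi => h i (by simp [hi]))

theorem convex_finset_sum {ι : Type*} (s : Finset ι) {A : ι → Set X}
    (h : ∀ i ∈ s, Convex ℝ (A i)) : Convex ℝ (∑ i ∈ s, A i) := by
  classical
  induction s using Finset.induction_on with
  | empty => simpa only [Finset.sum_empty, singleton_zero] using convex_singleton (𝕜 := ℝ) (0 : X)
  | insert a s ha ih =>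
    rw [Finset.sum_insert ha]
    exact (h a (by simp)).add (ih fun i hi => h i (by simp [hi]))

theorem suppFn_finset_sum {ι : Type*} (s : Finset ι) {A : ι → Set X}
    (hne : ∀ i ∈ s, (A i).Nonempty) (h : ∀ i ∈ s, IsBounded (A i)) (y : X →L[ℝ] ℝ) :
    suppFn y (∑ i ∈ s, A i) = ∑ i ∈ s, suppFn y (A i) := by
  classical
  induction s using Finset.induction_on with
  | empty => simp [suppFn]
  | insert a s ha ih =>
    have hne' : ∀ i ∈ s, (A i).Nonempty := fun i hi => hne i (by simp [hi])
    have h' : ∀ i ∈ s, IsBounded (A i) := fun i hi => h i (by simp [hi])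
    have hs : (∑ i ∈ s, A i).Nonempty := by
      choose! g hg using hne'
      exact ⟨_, finsetSum_mem_finsetSum _ _ _ hg⟩
    rw [Finset.sum_insert ha, Finset.sum_insert ha, suppFn_add (hne a (by simp)) hs
      (h a (by simp)) (isBounded_finset_sum s h'), ih hne' h']

theorem isBounded_mSum {n : ℕ} (P : TP n) {Γ : ℝ → Set X}
    (hΓ : ∀ t ∈ Icc (0:ℝ) 1, IsCWK X (Γ t)) : IsBounded (mSum P Γ) :=
  isBounded_finset_sum _ fun i _ => (hΓ _ (P.tagMem i)).isBounded.smul₀ _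

theorem convex_mSum {n : ℕ} (P : TP n) {Γ : ℝ → Set X}
    (hΓ : ∀ t ∈ Icc (0:ℝ) 1, IsCWK X (Γ t)) : Convex ℝ (mSum P Γ) :=
  convex_finset_sum _ fun i _ => (hΓ _ (P.tagMem i)).2.1.smul _

theorem suppFn_mSum {n : ℕ} (P : TP n) {Γ : ℝ → Set X}
    (hΓ : ∀ t ∈ Icc (0:ℝ) 1, IsCWK X (Γ t)) (y : X →L[ℝ] ℝ) :
    suppFn y (mSum P Γ) = fSum P fun t => suppFn y (Γ t) := by
  rw [mSum, suppFn_finset_sum _ (fun i _ => (hΓ _ (P.tagMem i)).1.smul_set)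
    fun i _ => (hΓ _ (P.tagMem i)).isBounded.smul₀ _]
  exact Finset.sum_congr rfl fun i _ => suppFn_smul _ (P.len_nonneg i) y

theorem mSum_add_singleton {n : ℕ} (P : TP n) (Γ : ℝ → Set X) (f : ℝ → X) :
    mSum P (fun t => Γ t + {f t}) = mSum P Γ + {fSum P f} := by
  have h : ∑ i, ({P.len i • f (P.tag i)} : Set X) = {∑ i, P.len i • f (P.tag i)} :=
    (map_sum (singletonAddMonoidHom : X →+ Set X) _ _).symm
  simp only [mSum, fSum, smul_add, smul_set_singleton, Finset.sum_add_distrib, h]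

/-! ### Decomposition of an `ℋ`-integrable multifunction -/

theorem HMeasIntegrable.exists_selection {Γ : ℝ → Set X}
    (hΓ : ∀ t ∈ Icc (0:ℝ) 1, IsCWK X (Γ t)) (h : HMeasIntegrable Γ) :
    ∃ f : ℝ → X, Selection Γ f ∧ FHMeasIntegrable f := by
  obtain ⟨I, hI, hint⟩ := h
  obtain ⟨x, hx, v, hmax, hexp⟩ := hI.exists_strongly_exposed
  have hsel : ∀ t, ∃ z, t ∈ Icc (0:ℝ) 1 → z ∈ Γ t ∧ ∀ w ∈ Γ t, v w ≤ v z := by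
    intro t
    by_cases ht : t ∈ Icc (0:ℝ) 1
    · obtain ⟨z, hz, hzmax⟩ := exists_forall_le_of_isCompact_weak (hΓ t ht).1 (hΓ t ht).2.2 v
      exact ⟨z, fun _ => ⟨hz, hzmax⟩⟩
    · exact ⟨0, fun h => (ht h).elim⟩
  choose f hf using hsel
  have hfΓ : Selection Γ f := fun t ht => (hf t ht).1
  have hfmax : ∀ {n : ℕ} (P : TP n), ∀ z ∈ mSum P Γ, v z ≤ v (fSum P f) := by
    intro n P z hz
    obtain ⟨g, hg, rfl⟩ := (mem_fintype_sum _ _).1 hz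
    simp only [fSum, map_sum]
    refine Finset.sum_le_sum fun i _ => ?_
    obtain ⟨w, hw, hwg⟩ := hg i
    rw [← hwg]
    simp only [map_smul]
    exact smul_le_smul_of_nonneg_left ((hf _ (P.tagMem i)).2 w hw) (P.len_nonneg i)
  refine ⟨f, hfΓ, x, fun ε hε => ?_⟩
  obtain ⟨α, hα, hα'⟩ := hexp (ε / 2) (half_pos hε)
  set K : ℝ := ‖v‖ + 1 with hK
  have hK0 : 0 < K := by positivity
  have hvK : ∀ a b : X, v a - v b ≤ K * dist a b := by
    intro a b
    rw [← map_sub, dist_eq_norm]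
    refine (le_abs_self _).trans ((v.le_opNorm _).trans ?_)
    gcongr
    linarith
  obtain ⟨δ, hδ, hδm, hδP⟩ := hint (min (ε / 2) (α / (2 * K))) (by positivity)
  refine ⟨δ, hδ, hδm, fun n P hP hfine => ?_⟩
  have hlt := hδP n P hP hfine
  have hfin : hausdorffEDist I (mSum P Γ) ≠ ⊤ :=
    hausdorffEDist_ne_top_of_nonempty_of_bounded hI.1
      (mSum_nonempty P fun t ht => (hΓ t ht).1) hI.isBounded (isBounded_mSum P hΓ)
  obtain ⟨s, hs, hxs⟩ := exists_dist_lt_of_hausdorffDist_lt hx hlt hfin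
  obtain ⟨z, hz, hzf⟩ := exists_dist_lt_of_hausdorffDist_lt' (fSum_mem_mSum P hfΓ) hlt hfin
  have h1 : K * dist x s < α / 2 := by
    have := hxs.trans_le (min_le_right _ _)
    rw [lt_div_iff₀ (by positivity)] at this
    linarith
  have h2 : K * dist (fSum P f) z < α / 2 := by
    have := hzf.trans_le (min_le_right _ _)
    rw [lt_div_iff₀ (by positivity), dist_comm] at this
    linarith
  have h3 := hα' z hz (by linarith [hvK x s, hvK (fSum P f) z, hfmax P s hs])
  rw [← dist_eq_norm] at h3 ⊢
  have := hzf.trans_le (min_le_left _ _)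
  linarith [dist_triangle_left x (fSum P f) z]

theorem FHMeasIntegrable.neg {f : ℝ → X} (hf : FHMeasIntegrable f) :
    FHMeasIntegrable fun t => -f t := by
  obtain ⟨w, hw⟩ := hf
  refine ⟨-w, fun ε hε => ?_⟩
  obtain ⟨δ, hδ, hδm, hδP⟩ := hw ε hε
  refine ⟨δ, hδ, hδm, fun n P hP hfine => ?_⟩
  have : -w - fSum P (fun t => -f t) = -(w - fSum P f) := by
    simp only [fSum, smul_neg, Finset.sum_neg_distrib]
    abel
  rw [this, norm_neg]
  exact hδP n P hP hfine

theorem HMeasIntegrable.add_singleton {Γ : ℝ → Set X} {f : ℝ → X}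
    (hΓ : ∀ t ∈ Icc (0:ℝ) 1, IsCWK X (Γ t)) (h : HMeasIntegrable Γ) (hf : FHMeasIntegrable f) :
    HMeasIntegrable fun t => Γ t + {f t} := by
  obtain ⟨I, hI, hint⟩ := h
  obtain ⟨w, hw⟩ := hf
  refine ⟨I + {w}, hI.add_singleton w, fun ε hε => ?_⟩
  obtain ⟨δ, hδ, hδm, hδP⟩ := hint (ε / 2) (half_pos hε)
  obtain ⟨δ', hδ', hδm', hδP'⟩ := hw (ε / 2) (half_pos hε)
  refine ⟨_, hδ.min hδ', hδm.min hδm', fun n P hP hfine => ?_⟩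
  have h1 := hδP n P hP (hfine.mono fun t => min_le_left _ _)
  have h2 := hδP' n P hP (hfine.mono fun t => min_le_right _ _)
  have hne : (mSum P Γ).Nonempty := mSum_nonempty P fun t ht => (hΓ t ht).1
  have hb := isBounded_mSum P hΓ
  rw [mSum_add_singleton]
  refine lt_of_le_of_lt (b := hausdorffDist I (mSum P Γ) + ‖w - fSum P f‖) ?_ (by linarith)
  refine hausdorffDist_le_of_suppFn (hI.1.add (singleton_nonempty _))
    (hne.add (singleton_nonempty _)) (hI.isBounded.add isBounded_singleton)
    (hb.add isBounded_singleton) (hI.2.1.add (convex_singleton _))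
    ((convex_mSum P hΓ).add (convex_singleton _))
    (add_nonneg hausdorffDist_nonneg (norm_nonneg _)) fun y hy => ?_
  rw [suppFn_add hI.1 (singleton_nonempty _) hI.isBounded isBounded_singleton,
    suppFn_add hne (singleton_nonempty _) hb isBounded_singleton, suppFn_singleton,
    suppFn_singleton, add_sub_add_comm, ← map_sub]
  refine (abs_add_le _ _).trans (add_le_add
    (abs_suppFn_sub_le hI.1 hne hI.isBounded hb hy) ?_)
  exact (y.le_opNorm _).trans (mul_le_of_le_one_left (norm_nonneg _) hy)

theorem HMeasIntegrable.birkhoffIntegrable {Γ : ℝ → Set X}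
    (hΓ : ∀ t ∈ Icc (0:ℝ) 1, IsCWK X (Γ t)) (h0 : ∀ t ∈ Icc (0:ℝ) 1, (0 : X) ∈ Γ t)
    (h : HMeasIntegrable Γ) : BirkhoffIntegrable Γ := by
  obtain ⟨I, hI, hint⟩ := h
  have hne : ∀ {n : ℕ} (P : TP n), (mSum P Γ).Nonempty :=
    fun P => mSum_nonempty P fun t ht => (hΓ t ht).1
  have hunif : UnifPerron (fun (y : closedBall (0 : X →L[ℝ] ℝ) 1) t => suppFn y.1 (Γ t))
      fun y => suppFn y.1 I := by
    intro ε hε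
    obtain ⟨δ, hδ, hδm, hδP⟩ := hint ε hε
    refine ⟨δ, hδ, hδm, fun n P hP hfine y => ?_⟩
    rw [← suppFn_mSum P hΓ, abs_sub_comm]
    exact (abs_suppFn_sub_le hI.1 (hne P) hI.isBounded (isBounded_mSum P hΓ)
      (mem_closedBall_zero_iff.1 y.2)).trans (hδP n P hP hfine).le
  have hbound : ∀ t, ∃ K, t ∈ Icc (0:ℝ) 1 → ∀ x ∈ Γ t, ‖x‖ ≤ K := by
    intro t
    by_cases ht : t ∈ Icc (0:ℝ) 1
    · obtain ⟨K, hK⟩ := isBounded_iff_forall_norm_le.1 (hΓ t ht).isBounded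
      exact ⟨K, fun _ => hK⟩
    · exact ⟨0, fun h => (ht h).elim⟩
  choose K hK using hbound
  refine ⟨I, hI, fun ε hε => ?_⟩
  obtain ⟨δ, hδ, hδm, hδP⟩ := hunif.mcShane
    (fun y t ht => by simpa using le_suppFn (hΓ t ht).isBounded y.1 (h0 t ht))
    (C := K) (fun t ht y => suppFn_le (hΓ t ht).1 _ fun x hx => (le_abs_self _).trans
      ((y.1.le_opNorm x).trans ((mul_le_of_le_one_left (norm_nonneg _)
        (mem_closedBall_zero_iff.1 y.2)).trans (hK t ht x hx)))) (half_pos hε)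
  refine ⟨δ, hδ, hδm, fun n P hfine => lt_of_le_of_lt ?_ (half_lt_self hε)⟩
  refine hausdorffDist_le_of_suppFn hI.1 (hne P) hI.isBounded (isBounded_mSum P hΓ) hI.2.1
    (convex_mSum P hΓ) (half_pos hε).le fun y hy => ?_
  rw [suppFn_mSum P hΓ, abs_sub_comm]
  exact hδP n P hfine ⟨y, mem_closedBall_zero_iff.2 hy⟩

theorem BirkhoffIntegrable.hMeasIntegrable {Γ : ℝ → Set X} (h : BirkhoffIntegrable Γ) :
    HMeasIntegrable Γ := by
  obtain ⟨I, hI, hint⟩ := h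
  refine ⟨I, hI, fun ε hε => ?_⟩
  obtain ⟨δ, hδ, hδm, hδP⟩ := hint ε hε
  exact ⟨δ, hδ, hδm, fun n P _ hfine => hδP n P hfine⟩

end Decomposition

/-- Theorem `t4a` of the paper. For a scalarly Henstock–Kurzweil integrable
multifunction `Γ : [0,1] → cwk(X)` the following are equivalent: (i) `Γ` is `ℋ`-integrable;
(ii) `Γ` has `ℋ`-integrable selections and for every `ℋ`-integrable selection `f` the
multifunction `Γ - f` is Birkhoff integrable; (iii) there is an `ℋ`-integrable selection `f`
of `Γ` with `Γ - f` Birkhoff integrable. -/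
theorem HMeas_decomposition_tfae
    {X : Type*} [NormedAddCommGroup X] [NormedSpace ℝ X] [CompleteSpace X]
    (Γ : ℝ → Set X) (hΓ : ∀ t ∈ Icc (0:ℝ) 1, IsCWK X (Γ t))
    (hsc : ∀ x' : X →L[ℝ] ℝ, HKIntegrable (fun t => suppFn x' (Γ t))) :
    List.TFAE [
      HMeasIntegrable Γ,
      (∃ f : ℝ → X, Selection Γ f ∧ FHMeasIntegrable f) ∧
        ∀ f : ℝ → X, Selection Γ f → FHMeasIntegrable f →
          BirkhoffIntegrable (fun t => Γ t - ({f t} : Set X)),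
      ∃ f : ℝ → X, Selection Γ f ∧ FHMeasIntegrable f ∧
        BirkhoffIntegrable (fun t => Γ t - ({f t} : Set X))
    ] := by
  tfae_have 1 → 2 := by
    refine fun h => ⟨h.exists_selection hΓ, fun f hf hfi => ?_⟩
    have hcwk : ∀ t ∈ Icc (0:ℝ) 1, IsCWK X (Γ t + {-f t}) :=
      fun t ht => (hΓ t ht).add_singleton _
    simp only [sub_singleton_eq]
    refine (h.add_singleton hΓ hfi.neg).birkhoffIntegrable hcwk fun t ht => ?_
    exact ⟨f t, hf t ht, -f t, rfl, add_neg_cancel _⟩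
  tfae_have 2 → 3 := fun ⟨⟨f, hf, hfi⟩, h⟩ => ⟨f, hf, hfi, h f hf hfi⟩
  tfae_have 3 → 1 := by
    rintro ⟨f, -, hfi, h⟩
    have hcwk : ∀ t ∈ Icc (0:ℝ) 1, IsCWK X (Γ t - {f t}) := fun t ht => by
      rw [sub_singleton_eq]
      exact (hΓ t ht).add_singleton _
    simpa only [sub_singleton_add_cancel] using h.hMeasIntegrable.add_singleton hcwk hfi
  tfae_finish

end GaugePaper
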